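/- arXiv:2507.14955 — 2 statements merged into one kernel-verified Lean document; each statement's English description precedes it below -/
import Mathlib

section
/- For every M > 0 and θ > 0 there exist η > 0 and Λ > 0 depending only on a, b, c, M, θ such that the following holds. Let ε ∈ (0,1), x ∈ ℝ³, and r ∈ (Λε, 1). If Q : B_{4r}(x) → S₀ is a smooth local minimizer of E_ε with sup_{B_{4r}(x)} |Q| ≤ M and r⁻¹ E_ε(Q, B_{2r}(x)) < η, then r² sup_{B_r(x)} e_ε(Q) ≤ θ. -/
noncomputable section

open Matrix MeasureTheory Metric Set

attribute [local instance] Matrix.normedAddCommGroup Matrix.normedSpace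

abbrev E3 : Type := EuclideanSpace ℝ (Fin 3)
abbrev M3 : Type := Matrix (Fin 3) (Fin 3) ℝ

/-- The space of symmetric traceless real 3×3 matrices. -/
def S0 : Set M3 := {Q | Q.IsSymm ∧ Q.trace = 0}

def sstar (a b c : ℝ) : ℝ := (b + Real.sqrt (b ^ 2 + 24 * a * c)) / (4 * c)

def kconst (a b c : ℝ) : ℝ :=
  sstar a b c ^ 2 / 27 * (9 * a + 2 * b * sstar a b c - 3 * c * sstar a b c ^ 2)

/-- Bulk potential. -/
def fbulk (a b c : ℝ) (Q : M3) : ℝ :=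
  kconst a b c - a / 2 * (Q * Q).trace - b / 3 * (Q * Q * Q).trace
    + c / 4 * ((Q * Q).trace) ^ 2

/-- Partial derivative `∂ₖ Q` (componentwise). -/
def pd (Q : E3 → M3) (k : Fin 3) (x : E3) : M3 :=
  Matrix.of fun i j => fderiv ℝ (fun y => Q y i j) x (EuclideanSpace.single k 1)

/-- Squared Frobenius norm of a matrix. -/
def frobSq (A : M3) : ℝ := ∑ i, ∑ j, (A i j) ^ 2

def frobNorm (A : M3) : ℝ := Real.sqrt (frobSq A)

/-- `|∇Q|²`. -/
def gradSq (Q : E3 → M3) (x : E3) : ℝ := ∑ k : Fin 3, frobSq (pd Q k x)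

/-- Energy density `e_ε(Q)`. -/
def eDen (a b c ε : ℝ) (Q : E3 → M3) (x : E3) : ℝ :=
  1 / 2 * gradSq Q x + 1 / ε ^ 2 * fbulk a b c (Q x)

/-- Energy `E_ε(Q, U)`. -/
def energy (a b c ε : ℝ) (Q : E3 → M3) (U : Set E3) : ℝ :=
  ∫ x in U, eDen a b c ε Q x

/-- Componentwise Laplacian. -/
def lapM (Q : E3 → M3) (x : E3) : M3 :=
  ∑ k : Fin 3, Matrix.of fun i j =>
    fderiv ℝ (fun y => pd Q k y i j) x (EuclideanSpace.single k 1)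

/-- `|Q|² = tr(Q²)`. -/
def normSqM (Q : M3) : ℝ := (Q * Q).trace

/-- The Euler–Lagrange equation at a point. -/
def ELeq (a b c ε : ℝ) (Q : E3 → M3) (x : E3) : Prop :=
  (-(ε ^ 2)) • lapM Q x - a • Q x - b • (Q x * Q x)
    + (b / 3 * normSqM (Q x)) • (1 : M3) + (c * normSqM (Q x)) • Q x = 0

/-- Local minimizer of the Landau–de Gennes energy on an open set `ω`. -/
def IsLDGMin (a b c ε : ℝ) (ω : Set E3) (Q : E3 → M3) : Prop :=
  ∀ (x : E3) (r : ℝ), 0 < r → closedBall x r ⊆ ω →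
    ∀ P : E3 → M3, ContDiffOn ℝ (⊤ : ℕ∞) P ω → (∀ y ∈ ω, P y ∈ S0) →
      (∃ K : Set E3, IsCompact K ∧ K ⊆ ball x r ∧ ∀ y ∉ K, P y = Q y) →
      energy a b c ε Q (ball x r) ≤ energy a b c ε P (ball x r)

/-- The vacuum manifold `N`. -/
def Nman (a b c : ℝ) : Set M3 :=
  {P | ∃ n : Fin 3 → ℝ, (∑ i, (n i) ^ 2) = 1 ∧
    P = sstar a b c • (Matrix.vecMulVec n n - (1 / 3 : ℝ) • (1 : M3))}

/-- Frobenius distance to the vacuum manifold. -/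
def distN (a b c : ℝ) (Q : M3) : ℝ :=
  sInf ((fun P => frobNorm (Q - P)) '' Nman a b c)

/-- Directional derivative `v·∇Q = Σₖ vₖ ∂ₖQ`. -/
def dirD (Q : E3 → M3) (v : E3) (x : E3) : M3 := ∑ k : Fin 3, v k • pd Q k x

/-- Admissible cutoff profile. -/
def AdmissibleCutoff (φ : ℝ → ℝ) : Prop :=
  ContDiff ℝ (⊤ : ℕ∞) φ ∧ (∀ t, 0 ≤ φ t) ∧ (∀ t, 10 ≤ t → φ t = 0) ∧
    (∀ t ∈ Icc (0 : ℝ) 8, 1 ≤ φ t) ∧ φ 0 = 60 ∧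
    (∀ t, 0 ≤ t → |deriv φ t| ≤ 100) ∧
    (∀ t ∈ Icc (0 : ℝ) 8, deriv φ t ∈ Icc (-2 : ℝ) (-1)) ∧
    (∀ t, 0 ≤ t → deriv φ t ≤ 0)

/-- The density `Θ_ρ^φ(Q, x)`. -/
def Theta (a b c ε : ℝ) (φ : ℝ → ℝ) (Q : E3 → M3) (x : E3) (ρ : ℝ) : ℝ :=
  ρ⁻¹ * ∫ y in ball x (Real.sqrt 10 * ρ), eDen a b c ε Q y * φ (‖y - x‖ ^ 2 / ρ ^ 2)

/-- The regular scale `r(Q, x)`. -/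
def regScale (a b c ε : ℝ) (Q : E3 → M3) (x : E3) : ℝ :=
  sSup {ρ : ℝ | 0 ≤ ρ ∧ ρ ≤ 1 ∧ ∀ y ∈ ball x ρ, ρ ^ 2 * eDen a b c ε Q y ≤ 1}

/-- The bad set `Bad(Q; s, δ)`. -/
def badSet (a b c ε : ℝ) (Q : E3 → M3) (s δ : ℝ) : Set E3 :=
  {y | regScale a b c ε Q y < s} ∪ {y | δ < distN a b c (Q y)}


/-! ## Calculus on `E3` -/

/-- Partial derivative of a scalar function. -/
def D (k : Fin 3) (u : E3 → ℝ) (y : E3) : ℝ := fderiv ℝ u y (EuclideanSpace.single k 1)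

/-- Smoothness abbreviation. -/
abbrev Sm (u : E3 → ℝ) : Prop := ContDiff ℝ (⊤ : ℕ∞) u

lemma Sm.diff {u : E3 → ℝ} (hu : Sm u) (y : E3) : DifferentiableAt ℝ u y :=
  (hu.differentiable (by simp)) y

lemma Sm.cont {u : E3 → ℝ} (hu : Sm u) : Continuous u := hu.continuous

lemma Sm.D {u : E3 → ℝ} (hu : Sm u) (k : Fin 3) : Sm (D k u) := by
  unfold _root_.D
  have h := hu.fderiv_right (m := (⊤ : ℕ∞)) (by simp)
  exact h.clm_apply contDiff_const

lemma D_add {u v : E3 → ℝ} (k : Fin 3) {y : E3} (hu : DifferentiableAt ℝ u y)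
    (hv : DifferentiableAt ℝ v y) :
    D k (fun z => u z + v z) y = D k u y + D k v y := by
  unfold D; rw [fderiv_fun_add hu hv]; simp

lemma D_sub {u v : E3 → ℝ} (k : Fin 3) {y : E3} (hu : DifferentiableAt ℝ u y)
    (hv : DifferentiableAt ℝ v y) :
    D k (fun z => u z - v z) y = D k u y - D k v y := by
  unfold D; rw [fderiv_fun_sub hu hv]; simp

lemma D_mul {u v : E3 → ℝ} (k : Fin 3) {y : E3} (hu : DifferentiableAt ℝ u y)
    (hv : DifferentiableAt ℝ v y) :
    D k (fun z => u z * v z) y = D k u y * v y + u y * D k v y := by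
  unfold D; rw [fderiv_fun_mul hu hv]; simp; ring

lemma D_sq {u : E3 → ℝ} (k : Fin 3) {y : E3} (hu : DifferentiableAt ℝ u y) :
    D k (fun z => u z ^ 2) y = 2 * u y * D k u y := by
  have := D_mul k hu hu
  simp only [← pow_two] at this
  rw [this]; ring

lemma D_const (k : Fin 3) (c : ℝ) (y : E3) : D k (fun _ => c) y = 0 := by
  unfold D; simp

lemma D_const_mul {u : E3 → ℝ} (k : Fin 3) {y : E3} (c : ℝ) (hu : DifferentiableAt ℝ u y) :
    D k (fun z => c * u z) y = c * D k u y := by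
  unfold D; rw [fderiv_const_mul hu]; simp

lemma D_sum {ι : Type*} (s : Finset ι) {u : ι → E3 → ℝ} (k : Fin 3) {y : E3}
    (hu : ∀ i ∈ s, DifferentiableAt ℝ (u i) y) :
    D k (fun z => ∑ i ∈ s, u i z) y = ∑ i ∈ s, D k (u i) y := by
  unfold D; rw [fderiv_fun_sum hu]; simp

lemma D_congr {u v : E3 → ℝ} (k : Fin 3) {y : E3} (h : u =ᶠ[nhds y] v) : D k u y = D k v y := by
  unfold D; rw [h.fderiv_eq]

lemma D_congr_on {u v : E3 → ℝ} {U : Set E3} (hU : IsOpen U) (h : ∀ y ∈ U, u y = v y)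
    (k : Fin 3) {y : E3} (hy : y ∈ U) : D k u y = D k v y :=
  D_congr k (Filter.eventuallyEq_of_mem (hU.mem_nhds hy) h)

lemma D_comm {u : E3 → ℝ} (hu : Sm u) (k l : Fin 3) (y : E3) :
    D k (D l u) y = D l (D k u) y := by
  have h2 : ∀ (k l : Fin 3), D k (D l u) y =
      fderiv ℝ (fderiv ℝ u) y (EuclideanSpace.single k 1) (EuclideanSpace.single l 1) := by
    intro k l
    have hd : DifferentiableAt ℝ (fderiv ℝ u) y :=
      ((hu.fderiv_right (m := (⊤ : ℕ∞)) (by simp)).differentiable (by simp)) y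
    unfold D
    rw [fderiv_clm_apply hd (by fun_prop)]
    simp
  rw [h2, h2]
  exact (hu.contDiffAt.isSymmSndFDerivAt (by simpa using WithTop.coe_le_coe.2 (le_top : (2 : ℕ∞) ≤ ⊤))) _ _

lemma D_coord (k i : Fin 3) (x y : E3) : D k (fun z => z i - x i) y = if k = i then 1 else 0 := by
  unfold D
  have h : HasFDerivAt (fun z : E3 => z i - x i) (EuclideanSpace.proj i : E3 →L[ℝ] ℝ) y :=
    (EuclideanSpace.proj i : E3 →L[ℝ] ℝ).hasFDerivAt.sub_const _
  rw [h.fderiv]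
  simp [eq_comm]

lemma sm_coord (i : Fin 3) (x : E3) : Sm (fun z => z i - x i) := by
  have : ContDiff ℝ (⊤ : ℕ∞) (fun z : E3 => (EuclideanSpace.proj i : E3 →L[ℝ] ℝ) z - x i) :=
    (EuclideanSpace.proj i : E3 →L[ℝ] ℝ).contDiff.sub contDiff_const
  exact this

/-- Squared distance to `x`. -/
def sqd (x : E3) (y : E3) : ℝ := ∑ i, (y i - x i) ^ 2

lemma sqd_eq (x y : E3) : sqd x y = dist y x ^ 2 := by
  rw [EuclideanSpace.dist_eq, Real.sq_sqrt (by positivity)]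
  simp [sqd, Real.dist_eq, sq_abs]

lemma sqd_nonneg (x y : E3) : 0 ≤ sqd x y := by unfold sqd; positivity

lemma sm_sqd (x : E3) : Sm (sqd x) := by
  unfold sqd
  exact ContDiff.sum fun i _ => (sm_coord i x).pow 2

lemma D_sqd (k : Fin 3) (x y : E3) : D k (sqd x) y = 2 * (y k - x k) := by
  unfold sqd
  rw [D_sum _ _ (fun i _ => Sm.diff (ContDiff.pow (sm_coord i x) 2) y)]
  simp only [fun i => D_sq k ((sm_coord i x).diff y), D_coord]
  simp

lemma D_comp {φ : ℝ → ℝ} {φ' : ℝ} {u : E3 → ℝ} (k : Fin 3) {y : E3}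
    (hφ : HasDerivAt φ φ' (u y)) (hu : DifferentiableAt ℝ u y) :
    D k (fun z => φ (u z)) y = φ' * D k u y := by
  unfold D
  have := (hφ.comp_hasFDerivAt y hu.hasFDerivAt).fderiv
  unfold Function.comp at this
  rw [this]; simp

lemma int_cs {u : E3 → ℝ} (hu : Continuous u) (hc : HasCompactSupport u) : Integrable u :=
  hu.integrable_of_hasCompactSupport hc

lemma cs_of_zero {u : E3 → ℝ} {x : E3} {R : ℝ} (h : ∀ y, R < dist y x → u y = 0) :
    HasCompactSupport u :=
  HasCompactSupport.intro (isCompact_closedBall x R) (fun y hy => h y (by simpa using hy))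

lemma D_zero_of_zero {u : E3 → ℝ} {x : E3} {R : ℝ} (h : ∀ y, R < dist y x → u y = 0)
    (k : Fin 3) (y : E3) (hy : R < dist y x) : D k u y = 0 := by
  have : u =ᶠ[nhds y] (fun _ => 0) := by
    have ho : IsOpen {y : E3 | R < dist y x} := isOpen_lt continuous_const (by fun_prop)
    exact Filter.eventuallyEq_of_mem (ho.mem_nhds hy) h
  rw [D_congr k this, D_const]

lemma int_D {u : E3 → ℝ} (hu : Sm u) {x : E3} {R : ℝ} (h : ∀ y, R < dist y x → u y = 0)
    (k : Fin 3) : ∫ y, D k u y = 0 := by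
  have h1 := integral_mul_fderiv_eq_neg_fderiv_mul_of_integrable (μ := (volume : Measure E3))
    (f := fun _ => (1 : ℝ)) (g := u) (v := EuclideanSpace.single k 1) (by simp)
    (by simpa [_root_.D] using! int_cs (hu.D k).cont (cs_of_zero (D_zero_of_zero h k)))
    (by simpa using int_cs hu.cont (cs_of_zero h)) (by simp) (fun y _ => hu.diff y)
  simpa [D] using h1

/-- A smooth cutoff profile. -/
lemma exists_cutoff : ∃ (χ : ℝ → ℝ) (K : ℝ), 1 ≤ K ∧ ContDiff ℝ (⊤ : ℕ∞) χ ∧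
    (∀ s, 0 ≤ χ s) ∧ (∀ s, χ s ≤ 1) ∧ (∀ s, s ≤ 1 / 2 → χ s = 1) ∧ (∀ s, 3 / 4 ≤ s → χ s = 0) ∧
    (∀ s, deriv χ s ≤ 0) ∧ (∀ s, |deriv χ s| ≤ K) ∧ (∀ s, |deriv (deriv χ) s| ≤ K) ∧
    (∀ s, s < 1 / 2 → deriv χ s = 0 ∧ deriv (deriv χ) s = 0) ∧
    (∀ s, 3 / 4 < s → deriv χ s = 0 ∧ deriv (deriv χ) s = 0) := by
  set χ : ℝ → ℝ := fun s => Real.smoothTransition (3 - 4 * s) with hχ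
  have hsm : ContDiff ℝ (⊤ : ℕ∞) χ := Real.smoothTransition.contDiff.comp (by fun_prop)
  have hsm1 : ContDiff ℝ (⊤ : ℕ∞) (deriv χ) := by
    have := (contDiff_infty_iff_deriv.1 hsm).2
    exact this
  have hsm2 : ContDiff ℝ (⊤ : ℕ∞) (deriv (deriv χ)) := by
    have := (contDiff_infty_iff_deriv.1 hsm1).2
    exact this
  have h1 : ∀ s, s ≤ 1 / 2 → χ s = 1 := fun s hs =>
    Real.smoothTransition.one_of_one_le (by linarith)
  have h0 : ∀ s, 3 / 4 ≤ s → χ s = 0 := fun s hs =>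
    Real.smoothTransition.zero_of_nonpos (by linarith)
  have d1 : ∀ s, s < 1 / 2 → deriv χ s = 0 := fun s hs => by
    have : χ =ᶠ[nhds s] fun _ => 1 :=
      Filter.eventuallyEq_of_mem (Iio_mem_nhds hs) (fun t ht => h1 t (le_of_lt ht))
    rw [this.deriv_eq]; simp
  have d0 : ∀ s, 3 / 4 < s → deriv χ s = 0 := fun s hs => by
    have : χ =ᶠ[nhds s] fun _ => 0 :=
      Filter.eventuallyEq_of_mem (Ioi_mem_nhds hs) (fun t ht => h0 t (le_of_lt ht))
    rw [this.deriv_eq]; simp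
  have dd1 : ∀ s, s < 1 / 2 → deriv (deriv χ) s = 0 := fun s hs => by
    have : deriv χ =ᶠ[nhds s] fun _ => 0 :=
      Filter.eventuallyEq_of_mem (Iio_mem_nhds hs) (fun t ht => d1 t ht)
    rw [this.deriv_eq]; simp
  have dd0 : ∀ s, 3 / 4 < s → deriv (deriv χ) s = 0 := fun s hs => by
    have : deriv χ =ᶠ[nhds s] fun _ => 0 :=
      Filter.eventuallyEq_of_mem (Ioi_mem_nhds hs) (fun t ht => d0 t ht)
    rw [this.deriv_eq]; simp
  obtain ⟨K1, hK1⟩ := (isCompact_Icc (a := (0:ℝ)) (b := 1)).exists_bound_of_continuousOn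
    hsm1.continuous.continuousOn
  obtain ⟨K2, hK2⟩ := (isCompact_Icc (a := (0:ℝ)) (b := 1)).exists_bound_of_continuousOn
    hsm2.continuous.continuousOn
  refine ⟨χ, max 1 (max K1 K2), le_max_left _ _, hsm, fun s => Real.smoothTransition.nonneg _,
    fun s => Real.smoothTransition.le_one _, h1, h0, ?_, ?_, ?_,
    fun s hs => ⟨d1 s hs, dd1 s hs⟩, fun s hs => ⟨d0 s hs, dd0 s hs⟩⟩
  · have hanti : Antitone χ := fun s t hst => Real.smoothTransition.monotone (by linarith)
    intro s
    exact hanti.deriv_nonpos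
  · intro s
    rcases lt_or_ge s (1 / 2) with h | h
    · rw [d1 s h]; simp
    rcases lt_or_ge (3 / 4) s with h' | h'
    · rw [d0 s h']; simp
    · exact (hK1 s ⟨by linarith, by linarith⟩).trans ((le_max_left _ _).trans (le_max_right _ _))
  · intro s
    rcases lt_or_ge s (1 / 2) with h | h
    · rw [dd1 s h]; simp
    rcases lt_or_ge (3 / 4) s with h' | h'
    · rw [dd0 s h']; simp
    · exact (hK2 s ⟨by linarith, by linarith⟩).trans ((le_max_right _ _).trans (le_max_right _ _))

/-! ## The regularised Green kernel and cutoffs -/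

/-- `u` has `k`-th partial derivative `d` at `y`. -/
def HD (k : Fin 3) (u : E3 → ℝ) (y : E3) (d : ℝ) : Prop := DifferentiableAt ℝ u y ∧ D k u y = d

lemma HD.mul {k : Fin 3} {u v : E3 → ℝ} {y : E3} {d e : ℝ} (hu : HD k u y d) (hv : HD k v y e) :
    HD k (fun z => u z * v z) y (d * v y + u y * e) :=
  ⟨hu.1.fun_mul hv.1, by rw [D_mul k hu.1 hv.1, hu.2, hv.2]⟩

lemma HD.add {k : Fin 3} {u v : E3 → ℝ} {y : E3} {d e : ℝ} (hu : HD k u y d) (hv : HD k v y e) :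
    HD k (fun z => u z + v z) y (d + e) :=
  ⟨hu.1.fun_add hv.1, by rw [D_add k hu.1 hv.1, hu.2, hv.2]⟩

lemma HD.sub {k : Fin 3} {u v : E3 → ℝ} {y : E3} {d e : ℝ} (hu : HD k u y d) (hv : HD k v y e) :
    HD k (fun z => u z - v z) y (d - e) :=
  ⟨hu.1.fun_sub hv.1, by rw [D_sub k hu.1 hv.1, hu.2, hv.2]⟩

lemma HD.sq {k : Fin 3} {u : E3 → ℝ} {y : E3} {d : ℝ} (hu : HD k u y d) :
    HD k (fun z => u z ^ 2) y (2 * u y * d) :=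
  ⟨hu.1.fun_pow 2, by rw [D_sq k hu.1, hu.2]⟩

lemma HD.cmul {k : Fin 3} {u : E3 → ℝ} {y : E3} {d : ℝ} (c : ℝ) (hu : HD k u y d) :
    HD k (fun z => c * u z) y (c * d) :=
  ⟨hu.1.const_mul c, by rw [D_const_mul k c hu.1, hu.2]⟩

lemma HD.sum {ι : Type*} {s : Finset ι} {k : Fin 3} {u : ι → E3 → ℝ} {y : E3} {d : ι → ℝ}
    (hu : ∀ i ∈ s, HD k (u i) y (d i)) :
    HD k (fun z => ∑ i ∈ s, u i z) y (∑ i ∈ s, d i) :=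
  ⟨DifferentiableAt.fun_sum fun i hi => (hu i hi).1, by
    rw [D_sum s k fun i hi => (hu i hi).1]
    exact Finset.sum_congr rfl fun i hi => (hu i hi).2⟩

lemma HD.of {k : Fin 3} {u : E3 → ℝ} (hu : Sm u) (y : E3) : HD k u y (D k u y) := ⟨hu.diff y, rfl⟩

lemma HD.coord (k i : Fin 3) (x y : E3) :
    HD k (fun z => z i - x i) y (if k = i then 1 else 0) := ⟨(sm_coord i x).diff y, D_coord k i x y⟩

/-- The regularised kernel. -/
def pk (x : E3) (ρ : ℝ) (y : E3) : ℝ := (Real.sqrt (sqd x y + ρ ^ 2))⁻¹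

lemma pk_arg_pos (x y : E3) {ρ : ℝ} (hρ : 0 < ρ) : 0 < sqd x y + ρ ^ 2 := by
  have := sqd_nonneg x y; positivity

lemma pk_pos (x y : E3) {ρ : ℝ} (hρ : 0 < ρ) : 0 < pk x ρ y :=
  inv_pos.2 (Real.sqrt_pos.2 (pk_arg_pos x y hρ))

lemma pk_sq (x y : E3) {ρ : ℝ} (hρ : 0 < ρ) : pk x ρ y ^ 2 * (sqd x y + ρ ^ 2) = 1 := by
  have := pk_arg_pos x y hρ
  rw [pk, inv_pow, Real.sq_sqrt this.le]
  exact inv_mul_cancel₀ this.ne'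

lemma sm_pk (x : E3) {ρ : ℝ} (hρ : 0 < ρ) : Sm (pk x ρ) := by
  unfold pk
  have h1 : ContDiff ℝ (⊤ : ℕ∞) (fun y => sqd x y + ρ ^ 2) := (sm_sqd x).add contDiff_const
  exact (h1.sqrt (fun y => (pk_arg_pos x y hρ).ne')).inv
    (fun y => (Real.sqrt_pos.2 (pk_arg_pos x y hρ)).ne')

lemma D_pk (x : E3) {ρ : ℝ} (hρ : 0 < ρ) (k : Fin 3) (y : E3) :
    D k (pk x ρ) y = -(y k - x k) * pk x ρ y ^ 3 := by
  have hp := pk_pos x y hρ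
  have h : ∀ z, pk x ρ z ^ 2 * (sqd x z + ρ ^ 2) = 1 := fun z => pk_sq x z hρ
  have h1 : HD k (fun z => pk x ρ z ^ 2 * (sqd x z + ρ ^ 2)) y _ :=
    (HD.of (k := k) (sm_pk x hρ) y).sq.mul
      ((HD.of (k := k) (sm_sqd x) y).add ⟨differentiableAt_const _, D_const k (ρ ^ 2) y⟩)
  have h2 := h1.2
  simp only [h] at h2
  rw [D_const, D_sqd] at h2
  have h3 := h y
  have : pk x ρ y * (D k (pk x ρ) y + (y k - x k) * pk x ρ y ^ 3) = 0 := by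
    have e : 2 * (pk x ρ y * (D k (pk x ρ) y + (y k - x k) * pk x ρ y ^ 3))
      = 2 * pk x ρ y * D k (pk x ρ) y * (1 - pk x ρ y ^ 2 * (sqd x y + ρ ^ 2))
        + pk x ρ y ^ 2 * (2 * pk x ρ y * D k (pk x ρ) y * (sqd x y + ρ ^ 2)
          + pk x ρ y ^ 2 * (2 * (y k - x k) + 0)) := by ring
    rw [h3, ← h2] at e
    linarith
  rcases mul_eq_zero.1 this with h | h
  · exact absurd h hp.ne'
  · linarith

lemma pk_lower {x y : E3} {ρ : ℝ} (hρ : 0 < ρ) (hy : dist y x < ρ) :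
    7 / 10 ≤ pk x ρ y * ρ := by
  have hp := pk_pos x y hρ
  have h := pk_sq x y hρ
  have hs : sqd x y ≤ ρ ^ 2 := by
    rw [sqd_eq]; exact pow_le_pow_left₀ dist_nonneg hy.le 2
  by_contra hlt
  push Not at hlt
  have h1 : (pk x ρ y * ρ) ^ 2 < (7 / 10) ^ 2 := pow_lt_pow_left₀ hlt (by positivity) (by norm_num)
  nlinarith [mul_le_mul_of_nonneg_left hs (sq_nonneg (pk x ρ y))]

lemma pk_upper {x y : E3} {ρ R : ℝ} (hρ : 0 < ρ) (hy : R ^ 2 / 2 ≤ sqd x y) :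
    pk x ρ y * R ≤ 3 / 2 := by
  have hp := pk_pos x y hρ
  have h := pk_sq x y hρ
  by_contra hlt
  push Not at hlt
  have h1 : (3 / 2) ^ 2 < (pk x ρ y * R) ^ 2 := pow_lt_pow_left₀ hlt (by positivity) (by norm_num)
  nlinarith [mul_le_mul_of_nonneg_left hy (sq_nonneg (pk x ρ y)), mul_pos (pow_pos hp 2) (pow_pos hρ 2)]

/-- Package of a smooth test function `ψ = χ(|y-x|²/R²) (|y-x|²+ρ²)^{-1/2}`. -/
lemma exists_test : ∃ K : ℝ, 1 ≤ K ∧ ∀ (x : E3) (R ρ : ℝ), 0 < ρ → ρ ≤ R / 2 →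
    ∃ ψ ψ₁ : E3 → ℝ, Sm ψ ∧ Sm ψ₁ ∧ (∀ y, 0 ≤ ψ y) ∧ (∀ y, ψ₁ y ≤ 0) ∧
      (∀ k y, D k ψ y = 2 * (y k - x k) * ψ₁ y) ∧
      (∀ y, 9 / 10 * R < dist y x → ψ y = 0 ∧ ψ₁ y = 0) ∧
      (∀ y, -(3 * K / R) ≤ ψ y + 2 * sqd x y * ψ₁ y) ∧
      (∀ y, dist y x < ρ → 1 / (3 * ρ) ≤ ψ y + 2 * sqd x y * ψ₁ y) ∧
      (∀ y, ∑ k, D k (D k ψ) y ≤ 30 * K / R ^ 3) ∧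
      (∀ y, dist y x < ρ → ∑ k, D k (D k ψ) y ≤ - (1 / (2 * ρ ^ 3))) := by
  obtain ⟨χ, K, hK, hsm, h0, h1, hone, hzero, hd, hK1, hK2, hin, hout⟩ := exists_cutoff
  refine ⟨K, hK, fun x R ρ hρ hρR => ?_⟩
  have hR : 0 < R := by linarith
  have hsm1 : ContDiff ℝ (⊤ : ℕ∞) (deriv χ) := (contDiff_infty_iff_deriv.1 hsm).2
  have hsm2 : ContDiff ℝ (⊤ : ℕ∞) (deriv (deriv χ)) := (contDiff_infty_iff_deriv.1 hsm1).2
  have hs0 : ContDiff ℝ (⊤ : ℕ∞) (fun y => sqd x y / R ^ 2) := (sm_sqd x).div_const _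
  set c0 : E3 → ℝ := fun y => χ (sqd x y / R ^ 2) with hc0
  set c1 : E3 → ℝ := fun y => 1 / R ^ 2 * deriv χ (sqd x y / R ^ 2) with hc1
  set c2 : E3 → ℝ := fun y => 1 / R ^ 4 * deriv (deriv χ) (sqd x y / R ^ 2) with hc2
  have sc0 : Sm c0 := hsm.comp hs0
  have sc1 : Sm c1 := contDiff_const.mul (hsm1.comp hs0)
  have Ds : ∀ k y, D k (fun y => sqd x y / R ^ 2) y = 2 * (y k - x k) / R ^ 2 := by
    intro k y
    have := D_const_mul k (1 / R ^ 2) ((sm_sqd x).diff y)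
    rw [D_sqd] at this
    convert this using 2
    · ext z; ring
    · ring
  have Dc0 : ∀ k y, HD k c0 y (2 * (y k - x k) * c1 y) := fun k y => ⟨sc0.diff y, by
    rw [hc0, D_comp k ((hsm.differentiable (by simp)) _).hasDerivAt (Sm.diff hs0 y), Ds, hc1]
    ring⟩
  have Dc1 : ∀ k y, HD k c1 y (2 * (y k - x k) * c2 y) := fun k y => ⟨sc1.diff y, by
    have hdd : DifferentiableAt ℝ (fun y => deriv χ (sqd x y / R ^ 2)) y :=
      Sm.diff (hsm1.comp hs0) y
    rw [hc1, D_const_mul k _ hdd,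
      D_comp k ((hsm1.differentiable (by simp)) _).hasDerivAt (Sm.diff hs0 y), Ds, hc2]
    ring⟩
  set p : E3 → ℝ := pk x ρ with hp
  have sp : Sm p := sm_pk x hρ
  have Dp : ∀ k y, HD k p y (-(y k - x k) * p y ^ 3) := fun k y => ⟨sp.diff y, D_pk x hρ k y⟩
  have ppos : ∀ y, 0 < p y := fun y => pk_pos x y hρ
  have psq : ∀ y, p y ^ 2 * (sqd x y + ρ ^ 2) = 1 := fun y => pk_sq x y hρ
  set ψ : E3 → ℝ := fun y => c0 y * p y with hψ
  set ψ₁ : E3 → ℝ := fun y => c1 y * p y - 1 / 2 * (c0 y * (p y * (p y) ^ 2)) with hψ₁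
  have sψ : Sm ψ := sc0.mul sp
  have sψ₁ : Sm ψ₁ := (sc1.mul sp).sub (contDiff_const.mul (sc0.mul (sp.mul (sp.pow 2))))
  have Dψ : ∀ k y, D k ψ y = 2 * (y k - x k) * ψ₁ y := fun k y => by
    rw [((Dc0 k y).mul (Dp k y)).2, hψ₁]; ring
  have Dψ₁ : ∀ k y, HD k ψ₁ y (2 * (y k - x k) * (c2 y * p y - c1 y * p y ^ 3
      + 3 / 4 * c0 y * p y ^ 5)) := fun k y => by
    have := ((Dc1 k y).mul (Dp k y)).sub
      (((Dc0 k y).mul ((Dp k y).mul ((Dp k y).sq))).cmul (1 / 2))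
    refine ⟨this.1, this.2.trans ?_⟩
    ring
  have lap : ∀ y, ∑ k, D k (D k ψ) y = -3 * ρ ^ 2 * c0 y * p y ^ 5 +
      (6 * c1 y * p y + 4 * sqd x y * c2 y * p y - 4 * sqd x y * c1 y * p y ^ 3) := by
    intro y
    have hk : ∀ k, D k (D k ψ) y = 2 * ψ₁ y + 4 * (y k - x k) ^ 2 * (c2 y * p y - c1 y * p y ^ 3
      + 3 / 4 * c0 y * p y ^ 5) := fun k => by
      have e : D k ψ = fun y => (2 * (y k - x k)) * ψ₁ y := funext (Dψ k)
      rw [e, (((HD.coord k k x y).cmul 2).mul (Dψ₁ k y)).2]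
      simp; ring
    simp only [hk, Finset.sum_add_distrib, ← Finset.sum_mul, ← Finset.mul_sum]
    rw [show ∑ i, (y i - x i) ^ 2 = sqd x y from rfl]
    simp only [Finset.sum_const, Finset.card_univ, Fintype.card_fin, hψ₁]
    have := psq y
    have e2 : c0 y * p y ^ 3 = c0 y * p y ^ 3 * (p y ^ 2 * (sqd x y + ρ ^ 2)) := by
      rw [this]; ring
    simp only [nsmul_eq_mul]
    push_cast
    linear_combination (-3) * e2
  have c0nn : ∀ y, 0 ≤ c0 y := fun y => h0 _
  have c1np : ∀ y, c1 y ≤ 0 := fun y => mul_nonpos_of_nonneg_of_nonpos (by positivity) (hd _)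
  have far : ∀ y, 9 / 10 * R < dist y x → 3 / 4 < sqd x y / R ^ 2 := fun y hy => by
    rw [lt_div_iff₀ (by positivity), sqd_eq]
    have : (9 / 10 * R) ^ 2 < dist y x ^ 2 := pow_lt_pow_left₀ hy (by positivity) (by norm_num)
    nlinarith [pow_pos hR 2]
  have near : ∀ y, dist y x < ρ → sqd x y / R ^ 2 < 1 / 2 := fun y hy => by
    rw [div_lt_iff₀ (by positivity), sqd_eq]
    have : dist y x ^ 2 < ρ ^ 2 := pow_lt_pow_left₀ hy dist_nonneg (by norm_num)
    have : ρ ^ 2 ≤ (R / 2) ^ 2 := pow_le_pow_left₀ hρ.le hρR 2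
    nlinarith [pow_pos hR 2]
  have nearv : ∀ y, dist y x < ρ → c0 y = 1 ∧ c1 y = 0 ∧ c2 y = 0 := fun y hy => by
    have hn := near y hy
    refine ⟨hone _ hn.le, ?_, ?_⟩
    · simp only [hc1]; rw [(hin _ hn).1]; simp
    · simp only [hc2]; rw [(hin _ hn).2]; simp
  have key : ∀ y, ψ y + 2 * sqd x y * ψ₁ y = ρ ^ 2 * c0 y * p y ^ 3 + 2 * sqd x y * c1 y * p y := by
    intro y
    have e2 : c0 y * p y = c0 y * p y * (p y ^ 2 * (sqd x y + ρ ^ 2)) := by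
      rw [psq y]; ring
    simp only [hψ, hψ₁]
    linear_combination e2
  -- on the transition region
  have trans : ∀ y, (c1 y = 0 ∧ c2 y = 0) ∨ (p y * R ≤ 3 / 2 ∧ sqd x y ≤ R ^ 2) := by
    intro y
    rcases lt_or_ge (sqd x y / R ^ 2) (1 / 2) with h | h
    · left; simp only [hc1, hc2]; rw [(hin _ h).1, (hin _ h).2]; simp
    rcases lt_or_ge (3 / 4) (sqd x y / R ^ 2) with h' | h'
    · left; simp only [hc1, hc2]; rw [(hout _ h').1, (hout _ h').2]; simp
    right
    rw [le_div_iff₀ (by positivity)] at h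
    rw [div_le_iff₀ (by positivity)] at h'
    exact ⟨pk_upper hρ (by linarith), by nlinarith [pow_pos hR 2]⟩
  have c1b : ∀ y, |c1 y| * R ^ 2 ≤ K := fun y => by
    simp only [hc1]; rw [abs_mul, abs_of_nonneg (by positivity)]
    have := hK1 (sqd x y / R ^ 2)
    field_simp; exact this
  have c2b : ∀ y, |c2 y| * R ^ 4 ≤ K := fun y => by
    simp only [hc2]; rw [abs_mul, abs_of_nonneg (by positivity)]
    have := hK2 (sqd x y / R ^ 2)
    field_simp; exact this
  refine ⟨ψ, ψ₁, sψ, sψ₁, fun y => mul_nonneg (c0nn y) (ppos y).le, fun y => ?_, Dψ, fun y hy => ?_,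
    fun y => ?_, fun y hy => ?_, fun y => ?_, fun y hy => ?_⟩
  · have := mul_nonpos_of_nonpos_of_nonneg (c1np y) (ppos y).le
    have := mul_nonneg (c0nn y) (mul_pos (ppos y) (pow_pos (ppos y) 2)).le
    simp only [hψ₁]; linarith
  · have hf := far y hy
    have e0 : c0 y = 0 := hzero _ hf.le
    have e1 : c1 y = 0 := by simp only [hc1]; rw [(hout _ hf).1]; simp
    simp only [hψ, hψ₁, e0, e1]; simp
  · rw [key]
    have hA : 0 ≤ ρ ^ 2 * c0 y * p y ^ 3 := by
      have := c0nn y; have := ppos y; positivity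
    rcases trans y with h | ⟨h, h'⟩
    · rw [h.1]
      have : 0 ≤ 3 * K / R := by positivity
      linarith
    · have hb : |2 * sqd x y * c1 y * p y| ≤ 3 * K / R := by
        rw [le_div_iff₀ hR, abs_mul, abs_mul, abs_of_nonneg (ppos y).le,
          abs_of_nonneg (by have := sqd_nonneg x y; positivity)]
        calc 2 * sqd x y * |c1 y| * p y * R ≤ 2 * R ^ 2 * |c1 y| * (3 / 2) := by
              rw [mul_assoc _ (p y) R]
              have := ppos y
              gcongr
          _ ≤ 3 * K := by have := c1b y; nlinarith
      have := (abs_le.1 hb).1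
      linarith
  · rw [key, (nearv y hy).1, (nearv y hy).2.1]
    have hl := pk_lower hρ hy
    rw [div_le_iff₀ (by positivity)]
    have : (7 / 10 : ℝ) ^ 3 ≤ (p y * ρ) ^ 3 := pow_le_pow_left₀ (by norm_num) hl 3
    nlinarith
  · rw [lap]
    have hA : 0 ≤ 3 * ρ ^ 2 * c0 y * p y ^ 5 := by
      have := c0nn y; have := ppos y; positivity
    rcases trans y with h | ⟨h, h'⟩
    · rw [h.1, h.2]
      have : 0 ≤ 30 * K / R ^ 3 := by positivity
      linarith
    · have t1 : c1 y * p y ≤ 0 := mul_nonpos_of_nonpos_of_nonneg (c1np y) (ppos y).le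
      have t2 : 4 * sqd x y * c2 y * p y ≤ 6 * K / R ^ 3 := by
        rw [le_div_iff₀ (by positivity)]
        calc 4 * sqd x y * c2 y * p y * R ^ 3 ≤ 4 * sqd x y * |c2 y| * p y * R ^ 3 := by
              have := ppos y; have := sqd_nonneg x y; gcongr; exact le_abs_self _
          _ = 4 * sqd x y * |c2 y| * (p y * R) * R ^ 2 := by ring
          _ ≤ 4 * R ^ 2 * |c2 y| * (3 / 2) * R ^ 2 := by
              have := ppos y; gcongr
          _ ≤ 6 * K := by have := c2b y; nlinarith
      have t3 : - (4 * sqd x y * c1 y * p y ^ 3) ≤ 14 * K / R ^ 3 := by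
        rw [le_div_iff₀ (by positivity)]
        calc - (4 * sqd x y * c1 y * p y ^ 3) * R ^ 3 = 4 * sqd x y * (-c1 y) * (p y * R) ^ 3 := by
              ring
          _ ≤ 4 * R ^ 2 * |c1 y| * (3 / 2) ^ 3 := by
              have := ppos y; have := sqd_nonneg x y
              have h5 := neg_le_abs (c1 y)
              have h6 : 0 ≤ -c1 y := by linarith [c1np y]
              gcongr
          _ ≤ 14 * K := by have := c1b y; nlinarith
      have : 30 * K / R ^ 3 = 6 * K / R ^ 3 + 14 * K / R ^ 3 + 10 * K / R ^ 3 := by ring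
      have : 0 ≤ 10 * K / R ^ 3 := by positivity
      linarith
  · rw [lap, (nearv y hy).1, (nearv y hy).2.1, (nearv y hy).2.2]
    have hl := pk_lower hρ hy
    have h5 : (7 / 10 : ℝ) ^ 5 ≤ (p y * ρ) ^ 5 := pow_le_pow_left₀ (by norm_num) hl 5
    have : 1 / (2 * ρ ^ 3) ≤ 3 * ρ ^ 2 * p y ^ 5 := by
      rw [div_le_iff₀ (by positivity)]
      nlinarith
    linarith

/-! ## Monotonicity, mean value inequality, Bochner, Schoen's argument -/

lemma div_scal {u ψ ψ₁ : E3 → ℝ} {x : E3} (hu : Sm u) (hψ : Sm ψ)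
    (Dψ : ∀ k y, D k ψ y = 2 * (y k - x k) * ψ₁ y) (y : E3) :
    ∑ i, D i (fun y => (1 / 2 * ∑ k, (D k u y) ^ 2) * ((y i - x i) * ψ y)
        - D i u y * ((∑ j, (y j - x j) * D j u y) * ψ y)) y
      = ψ y * (1 / 2 * ∑ k, (D k u y) ^ 2)
        + ψ₁ y * (sqd x y * (∑ k, (D k u y) ^ 2) - 2 * (∑ j, (y j - x j) * D j u y) ^ 2)
        - ψ y * (∑ k, D k (D k u) y) * (∑ j, (y j - x j) * D j u y) := by
  have hψ' : ∀ i, HD i ψ y (2 * (y i - x i) * ψ₁ y) := fun i => ⟨hψ.diff y, Dψ i y⟩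
  have h : ∀ i, D i (fun y => (1 / 2 * ∑ k, (D k u y) ^ 2) * ((y i - x i) * ψ y)
        - D i u y * ((∑ j, (y j - x j) * D j u y) * ψ y)) y = _ := fun i =>
    ((((HD.sum (s := Finset.univ) (fun k _ => (HD.of (k := i) (hu.D k) y).sq)).cmul (1 / 2)).mul
      ((HD.coord i i x y).mul (hψ' i))).sub ((HD.of (k := i) (hu.D i) y).mul
        ((HD.sum (s := Finset.univ) (fun j _ => (HD.coord i j x y).mul
          (HD.of (k := i) (hu.D j) y))).mul (hψ' i)))).2
  simp only [h]
  unfold sqd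
  simp only [Fin.sum_univ_three, Fin.isValue]
  have c01 := D_comm hu 0 1 y
  have c02 := D_comm hu 0 2 y
  have c12 := D_comm hu 1 2 y
  simp only [c01, c02, c12]
  simp
  ring

/-- Abstract energy density. -/
def eA {ι : Type*} [Fintype ι] (u : ι → E3 → ℝ) (F : E3 → ℝ) (y : E3) : ℝ :=
  ∑ α, (1 / 2 * ∑ k, (D k (u α) y) ^ 2) + F y

lemma sm_eA {ι : Type*} [Fintype ι] {u : ι → E3 → ℝ} {F : E3 → ℝ} (hu : ∀ α, Sm (u α))
    (hF : Sm F) : Sm (eA u F) := by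
  unfold eA
  exact (ContDiff.sum fun α _ => contDiff_const.mul (ContDiff.sum fun k _ => ((hu α).D k).pow 2)).add hF

lemma eA_nonneg {ι : Type*} [Fintype ι] {u : ι → E3 → ℝ} {F : E3 → ℝ} {y : E3} (hF : 0 ≤ F y) :
    0 ≤ eA u F y := by
  unfold eA; positivity

lemma int_ball {e : E3 → ℝ} (he : Continuous e) (x : E3) (R : ℝ) : IntegrableOn e (ball x R) :=
  (he.continuousOn.integrableOn_compact (isCompact_closedBall x R)).mono_set ball_subset_closedBall

lemma int_ball_ind {e : E3 → ℝ} (he : Continuous e) (c : ℝ) (x : E3) (R : ℝ) :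
    Integrable ((ball x R).indicator fun y => c * e y) :=
  IntegrableOn.integrable_indicator (int_ball (continuous_const.mul he) x R) measurableSet_ball

lemma mono_formula : ∃ C : ℝ, 0 < C ∧ ∀ {ι : Type} [Fintype ι] (u g : ι → E3 → ℝ) (F : E3 → ℝ)
    (_ : ∀ α, Sm (u α)) (_ : Sm F) (x : E3) (R ρ : ℝ) (_ : 0 < ρ) (_ : ρ ≤ R / 2)
    (_ : ∀ y ∈ ball x R, ∀ α, ∑ k, D k (D k (u α)) y = g α y)
    (_ : ∀ y ∈ ball x R, ∀ k, D k F y = ∑ α, g α y * D k (u α) y)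
    (_ : ∀ y ∈ ball x R, 0 ≤ F y),
    ρ⁻¹ * ∫ y in ball x ρ, eA u F y ≤ C * (R⁻¹ * ∫ y in ball x R, eA u F y) := by
  obtain ⟨K, hK, H⟩ := exists_test
  refine ⟨9 * K, by linarith, ?_⟩
  intro ι _ u g F hu hF x R ρ hρ hρR h1 h2 h3
  obtain ⟨ψ, ψ₁, sψ, sψ₁, ψnn, ψ₁np, Dψ, hout, hlow, hin, -, -⟩ := H x R ρ hρ hρR
  have hR : 0 < R := by linarith
  set W : Fin 3 → E3 → ℝ := fun i y =>
    ∑ α, ((1 / 2 * ∑ k, (D k (u α) y) ^ 2) * ((y i - x i) * ψ y)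
        - D i (u α) y * ((∑ j, (y j - x j) * D j (u α) y) * ψ y))
      + F y * ((y i - x i) * ψ y) with hW
  have sA : ∀ i α, Sm (fun y => (1 / 2 * ∑ k, (D k (u α) y) ^ 2) * ((y i - x i) * ψ y)
        - D i (u α) y * ((∑ j, (y j - x j) * D j (u α) y) * ψ y)) := fun i α =>
    ((contDiff_const.mul (ContDiff.sum fun k _ => ((hu α).D k).pow 2)).mul
      ((sm_coord i x).mul sψ)).sub (((hu α).D i).mul
        ((ContDiff.sum fun j _ => (sm_coord j x).mul ((hu α).D j)).mul sψ))
  have sB : ∀ i, Sm (fun y => F y * ((y i - x i) * ψ y)) := fun i => hF.mul ((sm_coord i x).mul sψ)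
  have sW : ∀ i, Sm (W i) := fun i => (ContDiff.sum fun α _ => sA i α).add (sB i)
  have zW : ∀ i y, 9 / 10 * R < dist y x → W i y = 0 := fun i y hy => by
    simp only [hW, (hout y hy).1]; simp
  have hint : ∫ y, ∑ i, D i (W i) y = 0 := by
    rw [integral_finsetSum _ (fun i _ => int_cs ((sW i).D i).cont
      (cs_of_zero (D_zero_of_zero (zW i) i)))]
    exact Finset.sum_eq_zero fun i _ => int_D (sW i) (zW i) i
  have hintg : Integrable (fun y => ∑ i, D i (W i) y) :=
    integrable_finsetSum _ (fun i _ => int_cs ((sW i).D i).cont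
      (cs_of_zero (D_zero_of_zero (zW i) i)))
  have hpt : ∀ y ∈ ball x R, eA u F y * (ψ y + 2 * sqd x y * ψ₁ y) ≤ ∑ i, D i (W i) y := by
    intro y hy
    have e1 : ∀ i, D i (W i) y = ∑ α, D i (fun y => (1 / 2 * ∑ k, (D k (u α) y) ^ 2) *
        ((y i - x i) * ψ y) - D i (u α) y * ((∑ j, (y j - x j) * D j (u α) y) * ψ y)) y
        + (D i F y * ((y i - x i) * ψ y) + F y * (1 * ψ y + (y i - x i) * (2 * (y i - x i) * ψ₁ y))) := by
      intro i
      have hB : HD i (fun y => F y * ((y i - x i) * ψ y)) y _ :=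
        (HD.of (k := i) hF y).mul ((HD.coord i i x y).mul ⟨sψ.diff y, Dψ i y⟩)
      have := ((HD.sum (s := Finset.univ) (fun α _ => HD.of (k := i) (sA i α) y)).add hB).2
      rw [if_pos rfl] at this
      exact this
    have e2 : ∑ i, D i (W i) y = ∑ α, (ψ y * (1 / 2 * ∑ k, (D k (u α) y) ^ 2)
        + ψ₁ y * (sqd x y * (∑ k, (D k (u α) y) ^ 2) - 2 * (∑ j, (y j - x j) * D j (u α) y) ^ 2)
        - ψ y * g α y * (∑ j, (y j - x j) * D j (u α) y))
        + (ψ y * ∑ i, (y i - x i) * D i F y + 3 * F y * ψ y + 2 * sqd x y * F y * ψ₁ y) := by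
      simp only [e1]
      rw [Finset.sum_add_distrib, Finset.sum_comm]
      congr 1
      · refine Finset.sum_congr rfl fun α _ => ?_
        rw [div_scal (hu α) sψ Dψ y, h1 y hy α]
      · unfold sqd
        simp only [Fin.sum_univ_three]; ring
    have e3 : ∑ i, (y i - x i) * D i F y = ∑ α, g α y * (∑ j, (y j - x j) * D j (u α) y) := by
      simp only [h2 y hy, Finset.mul_sum]
      rw [Finset.sum_comm]
      refine Finset.sum_congr rfl fun α _ => Finset.sum_congr rfl fun i _ => by ring
    have e4 : ∑ i, D i (W i) y = eA u F y * (ψ y + 2 * sqd x y * ψ₁ y) + 2 * F y * ψ y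
        + (-ψ₁ y) * ∑ α, 2 * (∑ j, (y j - x j) * D j (u α) y) ^ 2 := by
      rw [e2, e3]
      unfold eA
      rw [add_mul, Finset.sum_mul, Finset.mul_sum, Finset.mul_sum]
      have : ∑ α, (ψ y * (1 / 2 * ∑ k, (D k (u α) y) ^ 2)
        + ψ₁ y * (sqd x y * (∑ k, (D k (u α) y) ^ 2) - 2 * (∑ j, (y j - x j) * D j (u α) y) ^ 2)
        - ψ y * g α y * (∑ j, (y j - x j) * D j (u α) y)) =
        ∑ α, (1 / 2 * ∑ k, (D k (u α) y) ^ 2) * (ψ y + 2 * sqd x y * ψ₁ y) +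
        ∑ α, (-ψ₁ y) * (2 * (∑ j, (y j - x j) * D j (u α) y) ^ 2) -
        ∑ α, ψ y * (g α y * (∑ j, (y j - x j) * D j (u α) y)) := by
        rw [← Finset.sum_add_distrib, ← Finset.sum_sub_distrib]
        refine Finset.sum_congr rfl fun α _ => by ring
      rw [this]
      ring
    rw [e4]
    have p1 : 0 ≤ 2 * F y * ψ y := mul_nonneg (by linarith [h3 y hy]) (ψnn y)
    have p2 : 0 ≤ (-ψ₁ y) * ∑ α, 2 * (∑ j, (y j - x j) * D j (u α) y) ^ 2 :=
      mul_nonneg (by linarith [ψ₁np y]) (by positivity)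
    linarith
  have hec : Continuous (eA u F) := (sm_eA hu hF).cont
  have hle : ∫ y, ((ball x ρ).indicator (fun y => 1 / (3 * ρ) * eA u F y) y
      - (ball x R).indicator (fun y => 3 * K / R * eA u F y) y) ≤ ∫ y, ∑ i, D i (W i) y := by
    refine integral_mono ?_ hintg ?_
    · exact (int_ball_ind hec _ x ρ).sub
        (int_ball_ind hec _ x R)
    · intro y
      by_cases hyR : y ∈ ball x R
      · have he := eA_nonneg (u := u) (h3 y hyR)
        refine le_trans ?_ (hpt y hyR)
        simp only [indicator_of_mem hyR]
        by_cases hyρ : y ∈ ball x ρ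
        · rw [indicator_of_mem hyρ]
          have := hin y (by simpa using hyρ)
          have := mul_le_mul_of_nonneg_left this he
          have : 0 ≤ 3 * K / R * eA u F y := by positivity
          linarith
        · rw [indicator_of_notMem hyρ]
          have := mul_le_mul_of_nonneg_left (hlow y) he
          linarith
      · have hyρ : y ∉ ball x ρ := fun h => hyR (ball_subset_ball (by linarith) h)
        simp only [indicator_of_notMem hyR, indicator_of_notMem hyρ]
        have hd : 9 / 10 * R < dist y x := by
          simp only [mem_ball, not_lt] at hyR; linarith
        rw [Finset.sum_eq_zero fun i _ => D_zero_of_zero (zW i) i y hd]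
        simp
  rw [hint, integral_sub (int_ball_ind hec _ x ρ)
    (int_ball_ind hec _ x R),
    integral_indicator measurableSet_ball, integral_indicator measurableSet_ball,
    integral_const_mul, integral_const_mul] at hle
  have e1 : ρ⁻¹ * ∫ y in ball x ρ, eA u F y = 3 * (1 / (3 * ρ) * ∫ y in ball x ρ, eA u F y) := by
    field_simp
  have e2 : 9 * K * (R⁻¹ * ∫ y in ball x R, eA u F y) = 3 * (3 * K / R * ∫ y in ball x R, eA u F y) := by
    field_simp; ring
  rw [e1, e2]
  linarith

lemma vol_ball (x : E3) {ρ : ℝ} (hρ : 0 ≤ ρ) :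
    (volume (ball x ρ)).toReal = ρ ^ 3 * (volume (ball (0 : E3) 1)).toReal := by
  rw [Measure.addHaar_ball volume x hρ, ENNReal.toReal_mul,
    ENNReal.toReal_ofReal (by positivity)]
  simp

lemma vol_pos : 0 < (volume (ball (0 : E3) 1)).toReal :=
  ENNReal.toReal_pos (measure_ball_pos _ _ one_pos).ne' measure_ball_lt_top.ne

lemma mean_value : ∃ C : ℝ, 0 < C ∧ ∀ (w : E3 → ℝ) (_ : Sm w) (x : E3) (R : ℝ) (_ : 0 < R)
    (_ : ∀ y ∈ ball x R, 0 ≤ w y) (_ : ∀ y ∈ ball x R, 0 ≤ ∑ k, D k (D k w) y),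
    w x ≤ C * ((R ^ 3)⁻¹ * ∫ y in ball x R, w y) := by
  obtain ⟨K, hK, H⟩ := exists_test
  set v := (volume (ball (0 : E3) 1)).toReal with hv
  have vpos : 0 < v := vol_pos
  refine ⟨120 * K / v, by positivity, ?_⟩
  intro w sw x R hR h1 h2
  have hI : 0 ≤ ∫ y in ball x R, w y := setIntegral_nonneg measurableSet_ball h1
  rcases le_or_gt (w x) 0 with hx | hx
  · exact hx.trans (by positivity)
  obtain ⟨ρ0, hρ0, hball⟩ := Metric.continuousAt_iff.1 sw.cont.continuousAt (w x / 2) (by linarith)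
  set ρ := min ρ0 (R / 2) with hρdef
  have hρ : 0 < ρ := lt_min hρ0 (by linarith)
  have hρR : ρ ≤ R / 2 := min_le_right _ _
  have hwρ : ∀ y ∈ ball x ρ, w x / 2 ≤ w y := fun y hy => by
    have := hball (lt_of_lt_of_le (mem_ball.1 hy) (min_le_left _ _))
    rw [Real.dist_eq, abs_lt] at this
    linarith
  obtain ⟨ψ, ψ₁, sψ, sψ₁, ψnn, ψ₁np, Dψ, hout, -, -, hup, hin⟩ := H x R ρ hρ hρR
  have hψ0 : ∀ y, 9 / 10 * R < dist y x → ψ y = 0 := fun y hy => (hout y hy).1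
  set W : Fin 3 → E3 → ℝ := fun k y => w y * D k ψ y - ψ y * D k w y with hW
  have sW : ∀ i, Sm (W i) := fun i => (sw.mul (sψ.D i)).sub (sψ.mul (sw.D i))
  have zW : ∀ i y, 9 / 10 * R < dist y x → W i y = 0 := fun i y hy => by
    simp only [hW, hψ0 y hy, D_zero_of_zero hψ0 i y hy]; simp
  have hint : ∫ y, ∑ i, D i (W i) y = 0 := by
    rw [integral_finsetSum _ (fun i _ => int_cs ((sW i).D i).cont
      (cs_of_zero (D_zero_of_zero (zW i) i)))]
    exact Finset.sum_eq_zero fun i _ => int_D (sW i) (zW i) i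
  have hintg : Integrable (fun y => ∑ i, D i (W i) y) :=
    integrable_finsetSum _ (fun i _ => int_cs ((sW i).D i).cont
      (cs_of_zero (D_zero_of_zero (zW i) i)))
  have hpt : ∀ y, ∑ i, D i (W i) y = w y * ∑ k, D k (D k ψ) y - ψ y * ∑ k, D k (D k w) y := by
    intro y
    rw [Finset.mul_sum, Finset.mul_sum, ← Finset.sum_sub_distrib]
    refine Finset.sum_congr rfl fun i _ => ?_
    rw [(((HD.of (k := i) sw y).mul (HD.of (k := i) (sψ.D i) y)).sub
      ((HD.of (k := i) sψ y).mul (HD.of (k := i) (sw.D i) y))).2]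
    ring
  have iρ : Integrable ((ball x ρ).indicator (fun _ => w x / (4 * ρ ^ 3))) :=
    (integrableOn_const measure_ball_lt_top.ne).integrable_indicator measurableSet_ball
  have iR : Integrable ((ball x R).indicator (fun y => 30 * K / R ^ 3 * w y)) :=
    int_ball_ind sw.cont _ x R
  have hle : ∫ y, ∑ i, D i (W i) y ≤
      ∫ y, ((ball x R).indicator (fun y => 30 * K / R ^ 3 * w y) y
        - (ball x ρ).indicator (fun _ => w x / (4 * ρ ^ 3)) y) := by
    refine integral_mono hintg (iR.sub iρ) ?_
    intro y
    simp only [hpt]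
    by_cases hyR : y ∈ ball x R
    · have hw := h1 y hyR
      have hp := mul_nonneg (ψnn y) (h2 y hyR)
      simp only [indicator_of_mem hyR]
      by_cases hyρ : y ∈ ball x ρ
      · rw [indicator_of_mem hyρ]
        have a1 := mul_le_mul_of_nonneg_left (hin y (by simpa using hyρ)) hw
        have a2 : 0 ≤ 30 * K / R ^ 3 * w y := by positivity
        have a3 : w x / (4 * ρ ^ 3) ≤ w y * (1 / (2 * ρ ^ 3)) := by
          have := hwρ y hyρ
          have e : w x / (4 * ρ ^ 3) = w x / 2 * (1 / (2 * ρ ^ 3)) := by field_simp; ring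
          rw [e]; gcongr
        linarith
      · rw [indicator_of_notMem hyρ]
        have := mul_le_mul_of_nonneg_left (hup y) hw
        linarith
    · have hyρ : y ∉ ball x ρ := fun h => hyR (ball_subset_ball (by linarith) h)
      simp only [indicator_of_notMem hyR, indicator_of_notMem hyρ]
      have hd : 9 / 10 * R < dist y x := by
        simp only [mem_ball, not_lt] at hyR; linarith
      rw [← hpt, Finset.sum_eq_zero fun i _ => D_zero_of_zero (zW i) i y hd]
      simp
  rw [hint, integral_sub iR iρ,
    integral_indicator measurableSet_ball, integral_indicator measurableSet_ball,
    integral_const_mul, setIntegral_const, measureReal_def, vol_ball x hρ.le, ← hv] at hle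
  simp only [smul_eq_mul] at hle
  have e1 : ρ ^ 3 * v * (w x / (4 * ρ ^ 3)) = v / 4 * w x := by field_simp
  rw [e1] at hle
  have e2 : 120 * K / v * ((R ^ 3)⁻¹ * ∫ y in ball x R, w y) =
    4 / v * (30 * K / R ^ 3 * ∫ y in ball x R, w y) := by field_simp; ring
  have e3 : w x = 4 / v * (v / 4 * w x) := by field_simp
  rw [e2, e3]
  exact mul_le_mul_of_nonneg_left (by linarith) (by positivity)

lemma bochner {ι : Type} [Fintype ι] {u g : ι → E3 → ℝ} {F : E3 → ℝ}
    (hu : ∀ α, Sm (u α)) (hF : Sm F) (hg : ∀ α, Sm (g α)) {U : Set E3} (hU : IsOpen U)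
    (h1 : ∀ y ∈ U, ∀ α, ∑ k, D k (D k (u α)) y = g α y)
    (h2 : ∀ y ∈ U, ∀ k, D k F y = ∑ α, g α y * D k (u α) y) {y : E3} (hy : y ∈ U) :
    ∑ α, g α y ^ 2 + 2 * ∑ α, ∑ k, D k (g α) y * D k (u α) y ≤ ∑ k, D k (D k (eA u F)) y := by
  have s1 : ∀ k, ∀ y ∈ U, D k (eA u F) y = ∑ α, (∑ l, D l (u α) y * D k (D l (u α)) y
      + g α y * D k (u α) y) := by
    intro k y hy
    have : HD k (eA u F) y _ := (HD.sum (s := Finset.univ) (fun α _ =>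
      ((HD.sum (s := Finset.univ) (fun l _ => (HD.of (k := k) ((hu α).D l) y).sq)).cmul
        (1 / 2)))).add (HD.of (k := k) hF y)
    rw [this.2, h2 y hy k, ← Finset.sum_add_distrib]
    refine Finset.sum_congr rfl fun α _ => ?_
    rw [Finset.mul_sum]
    congr 1
    exact Finset.sum_congr rfl fun l _ => by ring
  have s2 : ∀ k, D k (D k (eA u F)) y = ∑ α, (∑ l, (D k (D l (u α)) y * D k (D l (u α)) y
      + D l (u α) y * D k (D k (D l (u α))) y)
      + (D k (g α) y * D k (u α) y + g α y * D k (D k (u α)) y)) := by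
    intro k
    rw [D_congr_on hU (s1 k) k hy]
    exact (HD.sum (s := Finset.univ) (fun α _ =>
      (HD.sum (s := Finset.univ) (fun l _ => (HD.of (k := k) ((hu α).D l) y).mul
        (HD.of (k := k) (((hu α).D l).D k) y))).add
        ((HD.of (k := k) (hg α) y).mul (HD.of (k := k) ((hu α).D k) y)))).2
  have s3 : ∀ l α, ∑ k, D k (D k (D l (u α))) y = D l (g α) y := by
    intro l α
    have : ∀ k, D k (D k (D l (u α))) y = D l (D k (D k (u α))) y := fun k => by
      have e : D k (D l (u α)) = D l (D k (u α)) := funext (D_comm (hu α) k l)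
      rw [e, D_comm ((hu α).D k)]
    simp only [this]
    rw [← D_sum _ _ (fun k _ => (((hu α).D k).D k).diff y)]
    exact D_congr_on hU (fun z hz => h1 z hz α) l hy
  simp only [s2]
  conv_rhs => rw [Finset.sum_comm]
  rw [Finset.mul_sum, ← Finset.sum_add_distrib]
  refine Finset.sum_le_sum fun α _ => ?_
  simp only [Finset.sum_add_distrib]
  have e1 : ∑ k, ∑ l, D l (u α) y * D k (D k (D l (u α))) y = ∑ k, D k (g α) y * D k (u α) y := by
    rw [Finset.sum_comm]
    refine Finset.sum_congr rfl fun l _ => ?_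
    rw [← Finset.mul_sum, s3, mul_comm]
  rw [e1, ← Finset.mul_sum, h1 y hy α]
  have : 0 ≤ ∑ k, ∑ l, D k (D l (u α)) y * D k (D l (u α)) y :=
    Finset.sum_nonneg fun k _ => Finset.sum_nonneg fun l _ => mul_self_nonneg _
  nlinarith

lemma schoen (C θ : ℝ) (hC : 0 ≤ C) (hθ : 0 < θ) : ∃ η : ℝ, 0 < η ∧
    ∀ {ι : Type} [Fintype ι] (u g : ι → E3 → ℝ) (F : E3 → ℝ)
    (_ : ∀ α, Sm (u α)) (_ : Sm F) (_ : ∀ α, Sm (g α)) (x : E3) (r : ℝ) (_ : 0 < r)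
    (_ : ∀ y ∈ ball x (2 * r), ∀ α, ∑ k, D k (D k (u α)) y = g α y)
    (_ : ∀ y ∈ ball x (2 * r), ∀ k, D k F y = ∑ α, g α y * D k (u α) y)
    (_ : ∀ y ∈ ball x (2 * r), 0 ≤ F y)
    (_ : ∀ y ∈ ball x (2 * r), -(C * eA u F y ^ 2) ≤
      ∑ α, g α y ^ 2 + 2 * ∑ α, ∑ k, D k (g α) y * D k (u α) y)
    (_ : r⁻¹ * ∫ y in ball x (2 * r), eA u F y < η),
    ∀ y ∈ ball x r, r ^ 2 * eA u F y ≤ θ := by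
  obtain ⟨C1, hC1, HM⟩ := mean_value
  obtain ⟨C2, hC2, HF⟩ := mono_formula
  set v := (volume (ball (0 : E3) 1)).toReal with hv
  have vpos : 0 < v := vol_pos
  set A := C1 * v * (16 * C / 6) + 1 with hA
  have Apos : 0 < A := by positivity
  set τ := min (θ / 256) (1 / (2 * A)) with hτ
  have τpos : 0 < τ := lt_min (by positivity) (by positivity)
  have τ1 : τ ≤ θ / 256 := min_le_left _ _
  have τ2 : τ * A ≤ 1 / 2 := by
    have := mul_le_mul_of_nonneg_right (min_le_right (θ / 256) (1 / (2 * A))) Apos.le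
    rw [← hτ] at this
    refine this.trans (le_of_eq ?_)
    field_simp
  refine ⟨τ / (4 * C1 * C2), by positivity, ?_⟩
  intro ι _ u g F hu hF hg x r hr h1 h2 h3 h4 h5 y hy
  set e := eA u F with he
  have se : Sm e := sm_eA hu hF
  have enn : ∀ y ∈ ball x (2 * r), 0 ≤ e y := fun y hy => eA_nonneg (h3 y hy)
  set h : E3 → ℝ := fun y => (3 * r / 2 - dist y x) ^ 2 * e y with hh
  have hcont : Continuous h := by
    have := se.cont
    fun_prop
  obtain ⟨y0, hy0, hmax⟩ := (isCompact_closedBall x (3 * r / 2)).exists_isMaxOn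
    ⟨x, mem_closedBall_self (by positivity)⟩ hcont.continuousOn
  rw [mem_closedBall] at hy0
  set d := 3 * r / 2 - dist y0 x with hd
  have hd0 : 0 ≤ d := by linarith
  have hdr : d ≤ 3 * r / 2 := by have := dist_nonneg (x := y0) (y := x); linarith
  have hmx : ∀ z, dist z x ≤ 3 * r / 2 → (3 * r / 2 - dist z x) ^ 2 * e z ≤ d ^ 2 * e y0 :=
    fun z hz => hmax (mem_closedBall.2 hz)
  have key : d ^ 2 * e y0 ≤ θ / 4 := by
    by_contra hcon
    push Not at hcon
    have hy02 : y0 ∈ ball x (2 * r) := by rw [mem_ball]; linarith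
    have e0nn := enn y0 hy02
    have e0pos : 0 < e y0 := by
      rcases e0nn.eq_or_lt with h0 | h0
      · rw [← h0] at hcon; linarith
      · exact h0
    have dpos : 0 < d := by
      rcases hd0.eq_or_lt with h0 | h0
      · rw [← h0] at hcon; linarith
      · exact h0
    set R := Real.sqrt (τ / e y0) with hRdef
    have Rpos : 0 < R := Real.sqrt_pos.2 (by positivity)
    have hR2 : e y0 * R ^ 2 = τ := by
      rw [hRdef, Real.sq_sqrt (by positivity)]; field_simp
    have hRd : R ≤ d / 8 := by
      by_contra hlt
      push Not at hlt
      have : (d / 8) ^ 2 < R ^ 2 := by gcongr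
      have := mul_lt_mul_of_pos_left this e0pos
      rw [hR2] at this
      linarith
    have hsub : ∀ z ∈ ball y0 R, z ∈ ball x (2 * r) := fun z hz => by
      rw [mem_ball] at *
      have := dist_triangle z y0 x
      linarith
    have hsub2 : ball y0 (r / 2) ⊆ ball x (2 * r) := fun z hz => by
      rw [mem_ball] at *
      have := dist_triangle z y0 x
      linarith
    have he4 : ∀ z ∈ ball y0 R, e z ≤ 4 * e y0 := fun z hz => by
      have hz' := hsub z hz
      have ez := enn z hz'
      rw [mem_ball] at hz
      have t := dist_triangle z y0 x
      have t2 : d / 2 ≤ 3 * r / 2 - dist z x := by linarith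
      have t3 := hmx z (by linarith)
      have t4 : (d / 2) ^ 2 ≤ (3 * r / 2 - dist z x) ^ 2 := by gcongr
      have t5 := mul_le_mul_of_nonneg_right t4 ez
      have t6 : d ^ 2 * e z ≤ d ^ 2 * (4 * e y0) := by linarith
      exact le_of_mul_le_mul_left t6 (by positivity)
    set L := 16 * C * e y0 ^ 2 / 6 with hL
    have Lnn : 0 ≤ L := by positivity
    set w : E3 → ℝ := fun z => e z + L * sqd y0 z with hw
    have sw : Sm w := se.add (contDiff_const.mul (sm_sqd y0))
    have hDw : ∀ k z, D k (D k w) z = D k (D k e) z + L * 2 := fun k z => by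
      have a1 : D k w = fun z => D k e z + L * (2 * (z k - y0 k)) := funext fun z => by
        have := ((HD.of (k := k) se z).add ((HD.of (k := k) (sm_sqd y0) z).cmul L)).2
        rw [D_sqd] at this
        exact this
      rw [a1]
      have := ((HD.of (k := k) (se.D k) z).add (((HD.coord k k y0 z).cmul 2).cmul L)).2
      rw [if_pos rfl] at this
      rw [this]; ring
    have hw0 : ∀ z ∈ ball y0 R, 0 ≤ w z := fun z hz =>
      add_nonneg (enn z (hsub z hz)) (mul_nonneg Lnn (sqd_nonneg _ _))
    have hΔ : ∀ z ∈ ball y0 R, 0 ≤ ∑ k, D k (D k w) z := fun z hz => by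
      have b1 := bochner hu hF hg isOpen_ball h1 h2 (hsub z hz)
      have b2 := h4 z (hsub z hz)
      have b3 : e z ^ 2 ≤ (4 * e y0) ^ 2 := by
        have := enn z (hsub z hz)
        have := he4 z hz
        gcongr
      have b4 := mul_le_mul_of_nonneg_left b3 hC
      simp only [hDw]
      rw [Finset.sum_add_distrib]
      simp only [Finset.sum_const, Finset.card_univ, Fintype.card_fin, nsmul_eq_mul]
      have : ((3 : ℕ) : ℝ) * (L * 2) = C * (4 * e y0) ^ 2 := by rw [hL]; push_cast; ring
      rw [this]
      linarith
    have m1 := HM w sw y0 R Rpos hw0 hΔ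
    have m2 : w y0 = e y0 := by simp [hw, sqd]
    have m3 : ∫ z in ball y0 R, w z ≤ (∫ z in ball y0 R, e z) + L * R ^ 2 * (R ^ 3 * v) := by
      have : ∫ z in ball y0 R, w z ≤ ∫ z in ball y0 R, (e z + L * R ^ 2) := by
        refine setIntegral_mono_on (int_ball sw.cont _ _)
          (int_ball (se.cont.add continuous_const) _ _) measurableSet_ball fun z hz => ?_
        rw [mem_ball] at hz
        have : sqd y0 z ≤ R ^ 2 := by
          rw [sqd_eq]
          have := dist_nonneg (x := z) (y := y0)
          gcongr
        simp only [hw]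
        gcongr
      refine this.trans (le_of_eq ?_)
      rw [integral_add (int_ball se.cont _ _) (int_ball continuous_const _ _),
        setIntegral_const, measureReal_def, vol_ball y0 Rpos.le, ← hv, smul_eq_mul]
      ring
    have m4 := HF u g F hu hF y0 (r / 2) R Rpos (by linarith) (fun z hz => h1 z (hsub2 hz))
      (fun z hz => h2 z (hsub2 hz)) (fun z hz => h3 z (hsub2 hz))
    have m5 : ∫ z in ball y0 (r / 2), e z ≤ ∫ z in ball x (2 * r), e z :=
      setIntegral_mono_set (int_ball se.cont _ _)
        ((ae_restrict_iff' measurableSet_ball).2 (Filter.Eventually.of_forall enn))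
        hsub2.eventuallyLE
    have m6 : R⁻¹ * ∫ z in ball y0 R, e z < C2 * (2 * (τ / (4 * C1 * C2))) := by
      refine m4.trans_lt ?_
      refine mul_lt_mul_of_pos_left ?_ hC2
      have : (r / 2)⁻¹ * ∫ z in ball y0 (r / 2), e z ≤ 2 * (r⁻¹ * ∫ z in ball x (2 * r), e z) := by
        have : (r / 2)⁻¹ = 2 * r⁻¹ := by field_simp
        rw [this, mul_assoc]
        gcongr
      linarith
    have m7 : R ^ 2 * e y0 ≤ C1 * (R⁻¹ * ∫ z in ball y0 R, e z) + C1 * v * (16 * C / 6) * τ ^ 2 := by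
      have : e y0 ≤ C1 * ((R ^ 3)⁻¹ * ((∫ z in ball y0 R, e z) + L * R ^ 2 * (R ^ 3 * v))) := by
        rw [m2] at m1
        refine m1.trans ?_
        gcongr
      have := mul_le_mul_of_nonneg_left this (sq_nonneg R)
      refine this.trans (le_of_eq ?_)
      rw [← hR2, hL]
      field_simp
    have m8 : C1 * (R⁻¹ * ∫ z in ball y0 R, e z) < τ / 2 := by
      have := mul_lt_mul_of_pos_left m6 hC1
      refine this.trans_le (le_of_eq ?_)
      field_simp; ring
    have m9 : C1 * v * (16 * C / 6) * τ ^ 2 ≤ τ / 2 := by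
      have e1 : C1 * v * (16 * C / 6) ≤ A := by rw [hA]; linarith
      calc C1 * v * (16 * C / 6) * τ ^ 2 ≤ A * τ ^ 2 := by gcongr
        _ = τ * (τ * A) := by ring
        _ ≤ τ * (1 / 2) := by gcongr
        _ = τ / 2 := by ring
    have : R ^ 2 * e y0 = τ := by rw [← hR2]; ring
    linarith
  rw [mem_ball] at hy
  have k1 := hmx y (by linarith)
  have k2 : (r / 2) ^ 2 ≤ (3 * r / 2 - dist y x) ^ 2 := by
    have : r / 2 ≤ 3 * r / 2 - dist y x := by linarith
    gcongr
  have k3 := mul_le_mul_of_nonneg_right k2 (enn y (by rw [mem_ball]; linarith))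
  linarith

/-! ## Algebra of the bulk potential, in terms of eigenvalues -/

lemma sstar_facts {a b c : ℝ} (ha : 0 ≤ a) (hb : 0 < b) (hc : 0 < c) :
    0 < sstar a b c ∧ 2 * c * sstar a b c ^ 2 - b * sstar a b c - 3 * a = 0 ∧
      b ≤ 2 * c * sstar a b c := by
  set w := Real.sqrt (b ^ 2 + 24 * a * c) with hw
  have hw2 : w ^ 2 = b ^ 2 + 24 * a * c := Real.sq_sqrt (by positivity)
  have hwb : b ≤ w := Real.le_sqrt_of_sq_le (by nlinarith [mul_nonneg ha hc.le])
  have hs : sstar a b c = (b + w) / (4 * c) := rfl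
  have hs' : 4 * c * sstar a b c = b + w := by rw [hs]; field_simp
  refine ⟨by rw [hs]; positivity, ?_, by linarith⟩
  have : 8 * c * (2 * c * sstar a b c ^ 2 - b * sstar a b c - 3 * a) = 0 := by
    have e : 8 * c * (2 * c * sstar a b c ^ 2 - b * sstar a b c - 3 * a) =
      (4 * c * sstar a b c) ^ 2 - 2 * b * (4 * c * sstar a b c) - 24 * a * c := by ring
    rw [e, hs']
    nlinarith
  exact (mul_eq_zero.1 this).resolve_left (by positivity)

/-- The bulk potential as a function of eigenvalues. -/
def fe (a b c x y z : ℝ) : ℝ :=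
  kconst a b c - a / 2 * (x ^ 2 + y ^ 2 + z ^ 2) - b / 3 * (x ^ 3 + y ^ 3 + z ^ 3)
    + c / 4 * (x ^ 2 + y ^ 2 + z ^ 2) ^ 2

/-- Component of the gradient of the potential. -/
def ge (a b c x u : ℝ) : ℝ := -a * x - b * (x ^ 2 - u / 3) + c * u * x

lemma fe_decomp {a b c : ℝ} (ha : 0 ≤ a) (hb : 0 < b) (hc : 0 < c) (x y z : ℝ) :
    ∃ T q : ℝ, 0 ≤ T ∧ 0 < q ∧ T ^ 2 = 3 / 2 * (x ^ 2 + y ^ 2 + z ^ 2) ∧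
      fe a b c x y z = (T - sstar a b c) ^ 2 * q + b / 3 * (2 * T ^ 3 / 9 - (x ^ 3 + y ^ 3 + z ^ 3)) := by
  obtain ⟨s0, s1, s2⟩ := sstar_facts ha hb hc
  set s := sstar a b c with hs
  set T := Real.sqrt (3 / 2 * (x ^ 2 + y ^ 2 + z ^ 2)) with hT
  have hT2 : T ^ 2 = 3 / 2 * (x ^ 2 + y ^ 2 + z ^ 2) := Real.sq_sqrt (by positivity)
  have hT0 : 0 ≤ T := Real.sqrt_nonneg _
  have β : 0 < (6 * c * s - 2 * b) / 27 := by linarith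
  have γ : 0 < s * (3 * c * s - b) / 27 := by
    have : 0 < 3 * c * s - b := by linarith
    positivity
  refine ⟨T, c / 9 * T ^ 2 + (6 * c * s - 2 * b) / 27 * T + s * (3 * c * s - b) / 27, hT0,
    by positivity, hT2, ?_⟩
  have hu : x ^ 2 + y ^ 2 + z ^ 2 = 2 / 3 * T ^ 2 := by rw [hT2]; ring
  have ha' : a = (2 * c * s ^ 2 - b * s) / 3 := by linarith
  unfold fe kconst
  rw [hu, ← hs, ha']
  ring

lemma p3_le {x y z T : ℝ} (h0 : x + y + z = 0) (hT : 0 ≤ T)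
    (hT2 : T ^ 2 = 3 / 2 * (x ^ 2 + y ^ 2 + z ^ 2)) : x ^ 3 + y ^ 3 + z ^ 3 ≤ 2 * T ^ 3 / 9 := by
  have hz : z = -x - y := by linarith
  refine le_trans (le_abs_self _) (abs_le_of_sq_le_sq ?_ (by positivity)) |>.trans le_rfl
  have : (2 * T ^ 3 / 9) ^ 2 = 4 / 81 * (T ^ 2) ^ 3 := by ring
  rw [this, hT2]
  have k : 4 / 81 * (3 / 2 * (x ^ 2 + y ^ 2 + z ^ 2)) ^ 3 - (x ^ 3 + y ^ 3 + z ^ 3) ^ 2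
      = 1 / 3 * ((x - y) * (y - z) * (x - z)) ^ 2 := by rw [hz]; ring
  nlinarith [sq_nonneg ((x - y) * (y - z) * (x - z))]

lemma fe_nonneg {a b c : ℝ} (ha : 0 ≤ a) (hb : 0 < b) (hc : 0 < c) {x y z : ℝ}
    (h0 : x + y + z = 0) : 0 ≤ fe a b c x y z := by
  obtain ⟨T, q, hT, hq, hT2, h⟩ := fe_decomp ha hb hc x y z
  rw [h]
  have := p3_le h0 hT hT2
  have : 0 ≤ 2 * T ^ 3 / 9 - (x ^ 3 + y ^ 3 + z ^ 3) := by linarith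
  positivity

lemma fe_fin {s : ℝ} (s0 : 0 < s) (x z : ℝ) (e0 : 2 * x + z = 0)
    (e1 : s ^ 2 = 3 / 2 * (x ^ 2 + x ^ 2 + z ^ 2))
    (e2 : x ^ 3 + x ^ 3 + z ^ 3 = 2 * s ^ 3 / 9) : z = 2 * s / 3 := by
  have hz : z = -2 * x := by linarith
  subst hz
  have : (s - 3 * x) * (s + 3 * x) = 0 := by linear_combination e1
  rcases mul_eq_zero.1 this with h | h
  · have hx : x = s / 3 := by linarith
    rw [hx] at e2
    have : 0 < s ^ 3 := by positivity
    exfalso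
    have : s ^ 3 = 0 := by linear_combination (-9/4) * e2
    linarith
  · linarith

lemma fe_zero {a b c : ℝ} (ha : 0 ≤ a) (hb : 0 < b) (hc : 0 < c) {x y z : ℝ}
    (h0 : x + y + z = 0) (hf : fe a b c x y z = 0) :
    (x = y ∧ z = 2 * sstar a b c / 3) ∨ (y = z ∧ x = 2 * sstar a b c / 3) ∨
      (x = z ∧ y = 2 * sstar a b c / 3) := by
  obtain ⟨T, q, hT, hq, hT2, h⟩ := fe_decomp ha hb hc x y z
  obtain ⟨s0, -, -⟩ := sstar_facts ha hb hc
  set s := sstar a b c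
  have hp := p3_le h0 hT hT2
  have h1 : 0 ≤ b / 3 * (2 * T ^ 3 / 9 - (x ^ 3 + y ^ 3 + z ^ 3)) :=
    mul_nonneg (by positivity) (by linarith)
  have h2 : 0 ≤ (T - s) ^ 2 * q := by positivity
  have h3 : (T - s) ^ 2 * q = 0 := by linarith
  have h4 : b / 3 * (2 * T ^ 3 / 9 - (x ^ 3 + y ^ 3 + z ^ 3)) = 0 := by linarith
  have hTs : T = s := by
    have := (mul_eq_zero.1 h3).resolve_right hq.ne'
    have := pow_eq_zero_iff (two_ne_zero) |>.1 this
    linarith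
  have h5 : x ^ 3 + y ^ 3 + z ^ 3 = 2 * T ^ 3 / 9 := by
    have := (mul_eq_zero.1 h4).resolve_left (by positivity)
    linarith
  have k : 1 / 3 * ((x - y) * (y - z) * (x - z)) ^ 2 =
      4 / 81 * (3 / 2 * (x ^ 2 + y ^ 2 + z ^ 2)) ^ 3 - (x ^ 3 + y ^ 3 + z ^ 3) ^ 2 := by
    have hz : z = -x - y := by linarith
    rw [hz]; ring
  rw [← hT2, h5] at k
  have k2 : (x - y) * (y - z) * (x - z) = 0 := by
    have : ((x - y) * (y - z) * (x - z)) ^ 2 = 0 := by linear_combination 3 * k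
    exact pow_eq_zero_iff (two_ne_zero) |>.1 this
  rw [hTs] at hT2 h5
  rcases mul_eq_zero.1 k2 with h | h
  · rcases mul_eq_zero.1 h with h | h
    · left
      have hx : x = y := by linarith
      subst hx
      exact ⟨rfl, fe_fin s0 x z (by linarith) (by linarith) (by linarith)⟩
    · right; left
      have hx : y = z := by linarith
      subst hx
      exact ⟨rfl, fe_fin s0 y x (by linarith) (by linarith) (by linarith)⟩
  · right; right
    have hx : x = z := by linarith
    subst hx
    exact ⟨rfl, fe_fin s0 x y (by linarith) (by linarith) (by linarith)⟩

lemma u_zero {a b c : ℝ} (ha : 0 ≤ a) (hb : 0 < b) (hc : 0 < c) {x y z : ℝ}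
    (h0 : x + y + z = 0) (hxy : x = y) (hz : z = 2 * sstar a b c / 3) :
    c * (x ^ 2 + y ^ 2 + z ^ 2) = b * sstar a b c / 3 + a ∧ x = - (sstar a b c / 3) := by
  obtain ⟨s0, s1, s2⟩ := sstar_facts ha hb hc
  set s := sstar a b c
  have hx : x = - (s / 3) := by linarith
  refine ⟨?_, hx⟩
  rw [← hxy, hz, hx]
  linear_combination s1 / 3

/-- Compact set of admissible eigenvalues. -/
def Kc (M : ℝ) : Set (ℝ × ℝ × ℝ) :=
  {p | p.1 + p.2.1 + p.2.2 = 0 ∧ p.1 ^ 2 + p.2.1 ^ 2 + p.2.2 ^ 2 ≤ M ^ 2}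

lemma Kc_compact {M : ℝ} : IsCompact (Kc M) := by
  have h1 : IsClosed (Kc M) := by
    have : Kc M = {p | p.1 + p.2.1 + p.2.2 = 0} ∩ {p | p.1 ^ 2 + p.2.1 ^ 2 + p.2.2 ^ 2 ≤ M ^ 2} := by
      ext p; exact Iff.rfl
    rw [this]
    refine IsClosed.inter (isClosed_eq ?_ continuous_const) (isClosed_le ?_ continuous_const) <;>
      fun_prop
  have h2 : Kc M ⊆ Icc (-|M|) |M| ×ˢ (Icc (-|M|) |M| ×ˢ Icc (-|M|) |M|) := by
    rintro ⟨x, y, z⟩ ⟨-, h⟩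
    simp only at h
    simp only [mem_prod, mem_Icc, ← abs_le]
    refine ⟨?_, ?_, ?_⟩ <;> refine sq_le_sq.1 ?_ <;> nlinarith [sq_nonneg x, sq_nonneg y, sq_nonneg z]
  exact (isCompact_Icc.prod (isCompact_Icc.prod isCompact_Icc)).of_isClosed_subset h1 h2

lemma mu_lower {a b c : ℝ} (ha : 0 ≤ a) (hb : 0 < b) (hc : 0 < c) (M : ℝ) :
    ∃ C : ℝ, 0 ≤ C ∧ ∀ x y z : ℝ, x + y + z = 0 → x ^ 2 + y ^ 2 + z ^ 2 ≤ M ^ 2 →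
      -(C * (|ge a b c x (x ^ 2 + y ^ 2 + z ^ 2)| + |ge a b c y (x ^ 2 + y ^ 2 + z ^ 2)|
        + fe a b c x y z)) ≤ -a + b * z + c * (x ^ 2 + y ^ 2 + z ^ 2) := by
  set μ : ℝ × ℝ × ℝ → ℝ := fun p => -a + b * p.2.2 + c * (p.1 ^ 2 + p.2.1 ^ 2 + p.2.2 ^ 2) with hμ
  have μc : Continuous μ := by fun_prop
  set φ : ℝ × ℝ × ℝ → ℝ := fun p => |p.1 - p.2.1| + fe a b c p.1 p.2.1 p.2.2 with hφ
  have φc : Continuous φ := by unfold φ fe; fun_prop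
  have hS : IsCompact (Kc M ∩ {p | μ p ≤ 0}) :=
    Kc_compact.inter_right (isClosed_le μc continuous_const)
  obtain ⟨δ, hδ, H⟩ := hS.exists_forall_le' φc.continuousOn (a := 0) (by
    rintro ⟨x, y, z⟩ ⟨⟨h0, h1⟩, h2⟩
    simp only [mem_ofPred_eq, hμ] at h0 h1 h2
    have hf := fe_nonneg ha hb hc h0
    have hab := abs_nonneg (x - y)
    simp only [hφ]
    by_contra hcon
    have f0 : fe a b c x y z = 0 := by linarith
    have xy : x = y := by
      have : |x - y| = 0 := by linarith
      linarith [abs_eq_zero.1 this]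
    obtain ⟨s0, s1, s2⟩ := sstar_facts ha hb hc
    have hz : z = 2 * sstar a b c / 3 := by
      rcases fe_zero ha hb hc h0 f0 with h | h | h
      · exact h.2
      · exfalso; linarith [h.1, h.2]
      · exfalso; linarith [h.1, h.2]
    have := (u_zero ha hb hc h0 xy hz).1
    rw [this, hz] at h2
    have : 0 < b * sstar a b c := by positivity
    linarith)
  obtain ⟨B, hB⟩ := (Kc_compact (M := M)).exists_bound_of_continuousOn μc.continuousOn
  refine ⟨(1 + |B|) / δ, by positivity, ?_⟩
  intro x y z h0 h1
  set u := x ^ 2 + y ^ 2 + z ^ 2 with hu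
  have hf := fe_nonneg ha hb hc h0
  have g1 := abs_nonneg (ge a b c x u)
  have g2 := abs_nonneg (ge a b c y u)
  have hm : μ (x, y, z) = -a + b * z + c * u := rfl
  rcases le_or_gt 0 (-a + b * z + c * u) with h | h
  · refine le_trans ?_ h
    rw [neg_nonpos]; positivity
  · have t1 := H (x, y, z) ⟨⟨h0, h1⟩, by rw [mem_ofPred_eq, hm]; exact h.le⟩
    have t2 := hB (x, y, z) ⟨h0, h1⟩
    rw [hm, Real.norm_eq_abs] at t2
    simp only [hφ] at t1
    have t3 : |x - y| * |-a + b * z + c * u| ≤ |ge a b c x u| + |ge a b c y u| := by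
      rw [← abs_mul]
      have : (x - y) * (-a + b * z + c * u) = ge a b c x u - ge a b c y u := by
        unfold ge
        have hz : z = -x - y := by linarith
        rw [hz]; ring
      rw [this]
      exact abs_sub _ _
    set m := |-a + b * z + c * u| with hmm
    have m0 : 0 ≤ m := abs_nonneg _
    have t4 : δ * m ≤ (1 + |B|) * (|ge a b c x u| + |ge a b c y u| + fe a b c x y z) := by
      have q1 : δ * m ≤ (|x - y| + fe a b c x y z) * m := by gcongr
      have q2 : m ≤ |B| := t2.trans (le_abs_self _)
      have q3 : fe a b c x y z * m ≤ fe a b c x y z * |B| := by gcongr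
      have q4 : 0 ≤ |B| * (|ge a b c x u| + |ge a b c y u|) := by positivity
      nlinarith
    have t5 : m ≤ (1 + |B|) / δ * (|ge a b c x u| + |ge a b c y u| + fe a b c x y z) := by
      rw [div_mul_eq_mul_div, le_div_iff₀ hδ]; linarith
    have := neg_abs_le (-a + b * z + c * u)
    linarith

/-- Diagonal part of the Hessian. -/
def NeH (a b c x y z d e f : ℝ) : ℝ :=
  -a * (d ^ 2 + e ^ 2 + f ^ 2) - 2 * b * (x * d ^ 2 + y * e ^ 2 + z * f ^ 2)
    + c * (2 * (x * d + y * e + z * f) ^ 2 + (x ^ 2 + y ^ 2 + z ^ 2) * (d ^ 2 + e ^ 2 + f ^ 2))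

lemma NeH_pos {a b c : ℝ} (ha : 0 ≤ a) (hb : 0 < b) (hc : 0 < c) {x y z d e f : ℝ}
    (h0 : x + y + z = 0) (hxy : x = y) (hz : z = 2 * sstar a b c / 3)
    (h1 : d + e + f = 0) (h2 : d ^ 2 + e ^ 2 + f ^ 2 = 1) : 0 < NeH a b c x y z d e f := by
  obtain ⟨s0, s1, s2⟩ := sstar_facts ha hb hc
  obtain ⟨u1, u2⟩ := u_zero ha hb hc h0 hxy hz
  set s := sstar a b c
  have hy : y = -(s / 3) := by rw [← hxy, u2]
  have k : NeH a b c x y z d e f = b * s + f ^ 2 * (2 * c * s ^ 2 - 2 * b * s) := by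
    have hd : d = -e - f := by linarith
    have h2' : 2 * e ^ 2 + 2 * e * f + 2 * f ^ 2 = 1 := by rw [← h2, hd]; ring
    have e1 : NeH a b c x y z d e f = -a - 2 * b * (x * d ^ 2 + y * e ^ 2 + z * f ^ 2) + (c * (2 * (x * d + y * e + z * f) ^ 2) + c * (x ^ 2 + y ^ 2 + z ^ 2)) := by
      unfold NeH; rw [h2]; ring
    rw [e1, u1, u2, hy, hz, hd]
    linear_combination (2 * b * s / 3) * h2'
  have hf : f ^ 2 ≤ 2 / 3 := by
    have : f = -d - e := by linarith
    rw [this] at h2 ⊢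
    nlinarith [sq_nonneg (d - e)]
  rw [k]
  have : 0 < b * s := by positivity
  nlinarith [mul_nonneg (sq_nonneg f) ha]

lemma diag_lower {a b c : ℝ} (ha : 0 ≤ a) (hb : 0 < b) (hc : 0 < c) (M : ℝ) :
    ∃ C : ℝ, 0 ≤ C ∧ ∀ x y z d e f : ℝ, x + y + z = 0 → x ^ 2 + y ^ 2 + z ^ 2 ≤ M ^ 2 →
      d + e + f = 0 →
      -(C * fe a b c x y z * (d ^ 2 + e ^ 2 + f ^ 2)) ≤ NeH a b c x y z d e f := by
  set N : (ℝ × ℝ × ℝ) × (ℝ × ℝ × ℝ) → ℝ :=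
    fun p => NeH a b c p.1.1 p.1.2.1 p.1.2.2 p.2.1 p.2.2.1 p.2.2.2 with hN
  have Nc : Continuous N := by unfold N NeH; fun_prop
  set φ : (ℝ × ℝ × ℝ) × (ℝ × ℝ × ℝ) → ℝ := fun p => fe a b c p.1.1 p.1.2.1 p.1.2.2 with hφ
  have φc : Continuous φ := by unfold φ fe; fun_prop
  have hK : IsCompact (Kc M ×ˢ Kc 1) := Kc_compact.prod Kc_compact
  have hS : IsCompact ((Kc M ×ˢ Kc 1) ∩ {p | p.2.1 ^ 2 + p.2.2.1 ^ 2 + p.2.2.2 ^ 2 = 1 ∧ N p ≤ 0}) := by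
    refine hK.inter_right ?_
    have : {p : (ℝ × ℝ × ℝ) × (ℝ × ℝ × ℝ) | p.2.1 ^ 2 + p.2.2.1 ^ 2 + p.2.2.2 ^ 2 = 1 ∧ N p ≤ 0} =
      {p | p.2.1 ^ 2 + p.2.2.1 ^ 2 + p.2.2.2 ^ 2 = 1} ∩ {p | N p ≤ 0} := by ext p; exact Iff.rfl
    rw [this]
    refine IsClosed.inter (isClosed_eq ?_ continuous_const) (isClosed_le Nc continuous_const)
    fun_prop
  obtain ⟨δ, hδ, H⟩ := hS.exists_forall_le' φc.continuousOn (a := 0) (by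
    rintro ⟨⟨x, y, z⟩, ⟨d, e, f⟩⟩ ⟨⟨⟨h0, h1⟩, ⟨h2, -⟩⟩, h3, h4⟩
    simp only [hN] at h0 h1 h2 h3 h4
    have hf := fe_nonneg ha hb hc h0
    simp only [hφ]
    refine lt_of_le_of_ne hf fun h => ?_
    rcases fe_zero ha hb hc h0 h.symm with h | h | h
    · have := NeH_pos ha hb hc h0 h.1 h.2 h2 h3
      linarith
    · have := NeH_pos ha hb hc (x := y) (y := z) (z := x) (d := e) (e := f) (f := d)
        (by linarith) h.1 h.2 (by linarith) (by linarith)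
      unfold NeH at this h4
      linarith
    · have := NeH_pos ha hb hc (x := x) (y := z) (z := y) (d := d) (e := f) (f := e)
        (by linarith) h.1 h.2 (by linarith) (by linarith)
      unfold NeH at this h4
      linarith)
  obtain ⟨B, hB⟩ := hK.exists_bound_of_continuousOn Nc.continuousOn
  refine ⟨|B| / δ, by positivity, ?_⟩
  intro x y z d e f h0 h1 h2
  have hf := fe_nonneg ha hb hc h0
  set w := Real.sqrt (d ^ 2 + e ^ 2 + f ^ 2) with hw
  have hw2 : w ^ 2 = d ^ 2 + e ^ 2 + f ^ 2 := Real.sq_sqrt (by positivity)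
  rcases (Real.sqrt_nonneg (d ^ 2 + e ^ 2 + f ^ 2)).eq_or_lt with hz | hpos
  · rw [← hw] at hz
    rw [← hz] at hw2
    have d0 : d = 0 := by nlinarith [sq_nonneg d, sq_nonneg e, sq_nonneg f]
    have e0 : e = 0 := by nlinarith [sq_nonneg d, sq_nonneg e, sq_nonneg f]
    have f0 : f = 0 := by linarith
    simp [NeH, d0, e0, f0]
  · rw [← hw] at hpos
    have hun : (d / w) ^ 2 + (e / w) ^ 2 + (f / w) ^ 2 = 1 := by
      field_simp; rw [hw2]
    have hs0 : d / w + e / w + f / w = 0 := by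
      rw [← add_div, ← add_div, h2, zero_div]
    have hhom : NeH a b c x y z d e f = w ^ 2 * NeH a b c x y z (d / w) (e / w) (f / w) := by
      unfold NeH; field_simp
    have key : -(|B| / δ * fe a b c x y z) ≤ NeH a b c x y z (d / w) (e / w) (f / w) := by
      rcases le_or_gt 0 (NeH a b c x y z (d / w) (e / w) (f / w)) with h | h
      · refine le_trans ?_ h
        rw [neg_nonpos]; positivity
      · have hmem : (((x, y, z), (d / w, e / w, f / w)) : (ℝ × ℝ × ℝ) × (ℝ × ℝ × ℝ)) ∈
            Kc M ×ˢ Kc 1 := ⟨⟨h0, h1⟩, ⟨hs0, by simp only; rw [hun]; norm_num⟩⟩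
        have t1 := H _ ⟨hmem, hun, h.le⟩
        have t2 := hB _ hmem
        simp only [hφ, hN, Real.norm_eq_abs] at t1 t2
        have t3 := (abs_le.1 (t2.trans (le_abs_self _))).1
        have : |B| ≤ |B| / δ * fe a b c x y z := by
          rw [div_mul_eq_mul_div, le_div_iff₀ hδ]; gcongr
        linarith
    rw [hhom, ← hw2]
    have := mul_le_mul_of_nonneg_left key (sq_nonneg w)
    linarith

/-! ## Matrix version of the algebra -/

/-- Gradient of the bulk potential in the space of symmetric traceless matrices. -/
def DfM (a b c : ℝ) (Q : M3) : M3 :=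
  -(a • Q) - b • (Q * Q) + (b / 3 * (Q * Q).trace) • (1 : M3) + (c * (Q * Q).trace) • Q

/-- Hessian of the bulk potential. -/
def hessM (a b c : ℝ) (Q A : M3) : ℝ :=
  -a * (A * A).trace - 2 * b * (Q * (A * A)).trace
    + c * (2 * (Q * A).trace ^ 2 + (Q * Q).trace * (A * A).trace)

lemma diagz {Q : M3} (hQ : Q.IsSymm) : ∃ (U V : M3) (l : Fin 3 → ℝ), U * V = 1 ∧ V * U = 1 ∧
    V = Uᵀ ∧ Q = U * diagonal l * V := by
  have hH : Q.IsHermitian := by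
    rw [Matrix.IsHermitian, conjTranspose_eq_transpose_of_trivial]; exact hQ
  refine ⟨hH.eigenvectorUnitary, star (hH.eigenvectorUnitary : M3), hH.eigenvalues,
    Unitary.coe_mul_star_self _, Unitary.coe_star_mul_self _, ?_, ?_⟩
  · rw [star_eq_conjTranspose, conjTranspose_eq_transpose_of_trivial]
  · have := hH.spectral_theorem
    rw [Unitary.conjStarAlgAut_apply] at this
    simpa using! this

lemma tr_cj {U V : M3} (h : V * U = 1) (X : M3) : (U * X * V).trace = X.trace := by
  rw [trace_mul_cycle, h, one_mul]

lemma cj_mul {U V : M3} (h : V * U = 1) (X Y : M3) :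
    (U * X * V) * (U * Y * V) = U * (X * Y) * V := by
  calc (U * X * V) * (U * Y * V) = U * X * (V * U) * Y * V := by simp only [Matrix.mul_assoc]
    _ = _ := by rw [h]; simp only [Matrix.mul_assoc, Matrix.one_mul]

lemma fbulk_diag (a b c : ℝ) (l : Fin 3 → ℝ) :
    fbulk a b c (diagonal l) = fe a b c (l 0) (l 1) (l 2) := by
  unfold fbulk fe
  simp only [diagonal_mul_diagonal, trace_diagonal, Fin.sum_univ_three]
  ring

lemma fbulk_cj (a b c : ℝ) {U V : M3} (h : V * U = 1) (X : M3) :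
    fbulk a b c (U * X * V) = fbulk a b c X := by
  unfold fbulk
  simp only [cj_mul h, tr_cj h]

lemma DfM_cj (a b c : ℝ) {U V : M3} (h : V * U = 1) (h' : U * V = 1) (X : M3) :
    DfM a b c (U * X * V) = U * DfM a b c X * V := by
  unfold DfM
  simp only [cj_mul h, tr_cj h]
  simp only [mul_add, add_mul, mul_sub, sub_mul, mul_neg, neg_mul, Matrix.mul_smul, Matrix.smul_mul,
    mul_one, h']

lemma hessM_cj (a b c : ℝ) {U V : M3} (h : V * U = 1) (X A : M3) :
    hessM a b c (U * X * V) (U * A * V) = hessM a b c X A := by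
  unfold hessM
  simp only [cj_mul h, tr_cj h]

lemma fbulk_nonneg {a b c : ℝ} (ha : 0 ≤ a) (hb : 0 < b) (hc : 0 < c) {Q : M3} (hQ : Q ∈ S0) :
    0 ≤ fbulk a b c Q := by
  obtain ⟨U, V, l, h1, h2, -, h4⟩ := diagz hQ.1
  have ht := hQ.2
  rw [h4, tr_cj h2, trace_diagonal, Fin.sum_univ_three] at ht
  rw [h4, fbulk_cj a b c h2, fbulk_diag]
  exact fe_nonneg ha hb hc ht

lemma trDf_diag (a b c : ℝ) (l : Fin 3 → ℝ) :
    (DfM a b c (diagonal l) * DfM a b c (diagonal l)).trace =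
      ge a b c (l 0) (l 0 ^ 2 + l 1 ^ 2 + l 2 ^ 2) ^ 2 +
      ge a b c (l 1) (l 0 ^ 2 + l 1 ^ 2 + l 2 ^ 2) ^ 2 +
      ge a b c (l 2) (l 0 ^ 2 + l 1 ^ 2 + l 2 ^ 2) ^ 2 := by
  have e : DfM a b c (diagonal l) =
      diagonal fun i => ge a b c (l i) (l 0 ^ 2 + l 1 ^ 2 + l 2 ^ 2) := by
    unfold DfM
    simp only [diagonal_mul_diagonal, trace_diagonal, Fin.sum_univ_three]
    ext i j
    by_cases h : i = j
    · subst h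
      simp [ge]; ring
    · simp [h]
  rw [e]
  simp only [diagonal_mul_diagonal, trace_diagonal, Fin.sum_univ_three]
  ring

lemma hessM_diag (a b c : ℝ) (l : Fin 3 → ℝ) (h0 : l 0 + l 1 + l 2 = 0) {B : M3} (hB : B.IsSymm) :
    hessM a b c (diagonal l) B = NeH a b c (l 0) (l 1) (l 2) (B 0 0) (B 1 1) (B 2 2)
      + 2 * B 0 1 ^ 2 * (-a + b * l 2 + c * (l 0 ^ 2 + l 1 ^ 2 + l 2 ^ 2))
      + 2 * B 0 2 ^ 2 * (-a + b * l 1 + c * (l 0 ^ 2 + l 1 ^ 2 + l 2 ^ 2))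
      + 2 * B 1 2 ^ 2 * (-a + b * l 0 + c * (l 0 ^ 2 + l 1 ^ 2 + l 2 ^ 2)) := by
  have e1 : B 1 0 = B 0 1 := hB.apply 0 1
  have e2 : B 2 0 = B 0 2 := hB.apply 0 2
  have e3 : B 2 1 = B 1 2 := hB.apply 1 2
  unfold hessM NeH
  simp only [trace, diag_apply, Matrix.mul_apply, Fin.sum_univ_three, e1, e2, e3]
  simp
  have hl : l 0 = -l 1 - l 2 := by linarith
  rw [hl]
  ring

set_option maxHeartbeats 1000000 in
lemma hess_lower {a b c : ℝ} (ha : 0 ≤ a) (hb : 0 < b) (hc : 0 < c) (M : ℝ) :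
    ∃ C : ℝ, 0 ≤ C ∧ ∀ Q ∈ S0, (Q * Q).trace ≤ M ^ 2 → ∀ A ∈ S0,
      -(C * (Real.sqrt (DfM a b c Q * DfM a b c Q).trace + fbulk a b c Q) * (A * A).trace)
        ≤ hessM a b c Q A := by
  obtain ⟨C1, hC1, H1⟩ := diag_lower ha hb hc M
  obtain ⟨C2, hC2, H2⟩ := mu_lower ha hb hc M
  refine ⟨C1 + 2 * C2, by positivity, ?_⟩
  intro Q hQ hM A hA
  obtain ⟨U, V, l, h1, h2, h3, h4⟩ := diagz hQ.1
  have ht := hQ.2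
  rw [h4, tr_cj h2, trace_diagonal, Fin.sum_univ_three] at ht
  set B := V * A * U with hBdef
  have hAB : A = U * B * V := by
    rw [hBdef]
    calc A = (U * V) * A * (U * V) := by rw [h1]; simp
      _ = _ := by simp only [Matrix.mul_assoc]
  have hB : B.IsSymm := by
    have hA1 : Aᵀ = A := hA.1
    rw [Matrix.IsSymm, hBdef, transpose_mul, transpose_mul, hA1, h3, transpose_transpose,
      Matrix.mul_assoc]
  have hBt : B.trace = 0 := by rw [← tr_cj h2 B, ← hAB]; exact hA.2
  clear_value B
  rw [trace, Fin.sum_univ_three] at hBt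
  simp only [diag_apply] at hBt
  have hu : (Q * Q).trace = l 0 ^ 2 + l 1 ^ 2 + l 2 ^ 2 := by
    rw [h4, cj_mul h2, tr_cj h2]
    simp only [diagonal_mul_diagonal, trace_diagonal, Fin.sum_univ_three]
    ring
  rw [hu] at hM
  have hf : fbulk a b c Q = fe a b c (l 0) (l 1) (l 2) := by
    rw [h4, fbulk_cj a b c h2, fbulk_diag]
  have hG := trDf_diag a b c l
  rw [← tr_cj h2, ← cj_mul h2, ← DfM_cj a b c h2 h1, ← h4] at hG
  have hAA : (A * A).trace = B 0 0 ^ 2 + B 1 1 ^ 2 + B 2 2 ^ 2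
      + 2 * B 0 1 ^ 2 + 2 * B 0 2 ^ 2 + 2 * B 1 2 ^ 2 := by
    have e1 : B 1 0 = B 0 1 := hB.apply 0 1
    have e2 : B 2 0 = B 0 2 := hB.apply 0 2
    have e3 : B 2 1 = B 1 2 := hB.apply 1 2
    rw [hAB, cj_mul h2, tr_cj h2]
    simp only [trace, diag_apply, Matrix.mul_apply, Fin.sum_univ_three, e1, e2, e3]
    ring
  have hH := hessM_diag a b c l ht hB
  rw [← hessM_cj a b c h2, ← h4, ← hAB] at hH
  rw [hH, hG, hAA, hf]
  have m2 := H2 (l 0) (l 1) (l 2) ht hM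
  have m1 := H2 (l 0) (l 2) (l 1) (by linarith) (by linarith)
  have m0 := H2 (l 1) (l 2) (l 0) (by linarith) (by linarith)
  have d1 := H1 (l 0) (l 1) (l 2) (B 0 0) (B 1 1) (B 2 2) ht hM hBt
  have f1 : fe a b c (l 0) (l 2) (l 1) = fe a b c (l 0) (l 1) (l 2) := by unfold fe; ring
  have f0 : fe a b c (l 1) (l 2) (l 0) = fe a b c (l 0) (l 1) (l 2) := by unfold fe; ring
  have u1 : l 0 ^ 2 + l 2 ^ 2 + l 1 ^ 2 = l 0 ^ 2 + l 1 ^ 2 + l 2 ^ 2 := by ring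
  have u0 : l 1 ^ 2 + l 2 ^ 2 + l 0 ^ 2 = l 0 ^ 2 + l 1 ^ 2 + l 2 ^ 2 := by ring
  rw [f1, u1] at m1
  rw [f0, u0] at m0
  have hfn := fe_nonneg ha hb hc ht
  generalize fe a b c (l 0) (l 1) (l 2) = f at *
  generalize ge a b c (l 0) (l 0 ^ 2 + l 1 ^ 2 + l 2 ^ 2) = g0 at *
  generalize ge a b c (l 1) (l 0 ^ 2 + l 1 ^ 2 + l 2 ^ 2) = g1 at *
  generalize ge a b c (l 2) (l 0 ^ 2 + l 1 ^ 2 + l 2 ^ 2) = g2 at *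
  generalize NeH a b c (l 0) (l 1) (l 2) (B 0 0) (B 1 1) (B 2 2) = N at *
  generalize -a + b * l 2 + c * (l 0 ^ 2 + l 1 ^ 2 + l 2 ^ 2) = μ2 at *
  generalize -a + b * l 1 + c * (l 0 ^ 2 + l 1 ^ 2 + l 2 ^ 2) = μ1 at *
  generalize -a + b * l 0 + c * (l 0 ^ 2 + l 1 ^ 2 + l 2 ^ 2) = μ0 at *
  have G0 : |g0| ≤ Real.sqrt (g0 ^ 2 + g1 ^ 2 + g2 ^ 2) :=
    Real.abs_le_sqrt (by nlinarith [sq_nonneg g1, sq_nonneg g2])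
  have G1 : |g1| ≤ Real.sqrt (g0 ^ 2 + g1 ^ 2 + g2 ^ 2) :=
    Real.abs_le_sqrt (by nlinarith [sq_nonneg g0, sq_nonneg g2])
  have G2 : |g2| ≤ Real.sqrt (g0 ^ 2 + g1 ^ 2 + g2 ^ 2) :=
    Real.abs_le_sqrt (by nlinarith [sq_nonneg g0, sq_nonneg g1])
  have G := Real.sqrt_nonneg (g0 ^ 2 + g1 ^ 2 + g2 ^ 2)
  generalize Real.sqrt (g0 ^ 2 + g1 ^ 2 + g2 ^ 2) = S at *
  have aux : ∀ p q μ : ℝ, p ≤ S → q ≤ S → -(C2 * (p + q + f)) ≤ μ → ∀ t : ℝ,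
      -((C1 + 2 * C2) * (S + f) * (2 * t ^ 2)) ≤ 2 * t ^ 2 * μ := by
    intro p q μ hp hq hμ t
    have e1 : C2 * (p + q + f) ≤ (C1 + 2 * C2) * (S + f) := by
      have : C2 * (p + q + f) ≤ C2 * (S + S + f) := by gcongr
      have : 0 ≤ C1 * (S + f) + C2 * f := by positivity
      linarith
    have : -((C1 + 2 * C2) * (S + f)) ≤ μ := by linarith
    have := mul_le_mul_of_nonneg_left this (show 0 ≤ 2 * t ^ 2 by positivity)
    linarith
  have a2 := aux _ _ _ G0 G1 m2 (B 0 1)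
  have a1 := aux _ _ _ G0 G2 m1 (B 0 2)
  have a0 := aux _ _ _ G1 G2 m0 (B 1 2)
  have ad : -((C1 + 2 * C2) * (S + f) * (B 0 0 ^ 2 + B 1 1 ^ 2 + B 2 2 ^ 2)) ≤ N := by
    refine le_trans ?_ d1
    rw [neg_le_neg_iff]
    have : 0 ≤ C1 * S + 2 * C2 * (S + f) := by positivity
    exact mul_le_mul_of_nonneg_right (by linarith) (by positivity)
  linarith

/-! ## Calculus of matrix-valued maps -/

/-- Entrywise smoothness. -/
def SmM (P : E3 → M3) : Prop := ∀ i j, Sm (fun y => P y i j)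

/-- Entrywise partial derivative. -/
def HM (k : Fin 3) (P : E3 → M3) (y : E3) (A : M3) : Prop := ∀ i j, HD k (fun z => P z i j) y (A i j)

lemma SmM.HM {P : E3 → M3} (hP : SmM P) (k : Fin 3) (y : E3) : HM k P y (pd P k y) :=
  fun i j => ⟨(hP i j).diff y, rfl⟩

lemma SmM.pd {P : E3 → M3} (hP : SmM P) (k : Fin 3) : SmM (pd P k) := fun i j => (hP i j).D k

lemma SmM.add {P R : E3 → M3} (hP : SmM P) (hR : SmM R) : SmM (fun y => P y + R y) :=
  fun i j => (hP i j).add (hR i j)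

lemma SmM.mul {P R : E3 → M3} (hP : SmM P) (hR : SmM R) : SmM (fun y => P y * R y) := fun i j => by
  simp only [Matrix.mul_apply]
  exact ContDiff.sum fun l _ => (hP i l).mul (hR l j)

lemma SmM.smul {f : E3 → ℝ} {P : E3 → M3} (hf : Sm f) (hP : SmM P) : SmM (fun y => f y • P y) :=
  fun i j => hf.mul (hP i j)

lemma SmM.const (A : M3) : SmM (fun _ => A) := fun _ _ => contDiff_const

lemma SmM.trace {P : E3 → M3} (hP : SmM P) : Sm (fun y => (P y).trace) := by
  unfold Matrix.trace
  exact ContDiff.sum fun i _ => hP i i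

lemma SmM.sum {P : Fin 3 → E3 → M3} (hP : ∀ k, SmM (P k)) : SmM (fun y => ∑ k, P k y) := fun i j => by
  simp only [Matrix.sum_apply]
  exact ContDiff.sum fun k _ => hP k i j

lemma SmM.contDiff {P : E3 → M3} (hP : SmM P) : ContDiff ℝ (⊤ : ℕ∞) P :=
  contDiff_pi.2 fun i => contDiff_pi.2 fun j => hP i j

lemma HM.mul {k : Fin 3} {P R : E3 → M3} {y : E3} {A B : M3} (hP : HM k P y A) (hR : HM k R y B) :
    HM k (fun z => P z * R z) y (A * R y + P y * B) := fun i j => by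
  simp only [Matrix.mul_apply, Matrix.add_apply]
  rw [← Finset.sum_add_distrib]
  exact HD.sum fun l _ => (hP i l).mul (hR l j)

lemma HM.trace {k : Fin 3} {P : E3 → M3} {y : E3} {A : M3} (hP : HM k P y A) :
    HD k (fun z => (P z).trace) y A.trace := by
  unfold Matrix.trace
  exact HD.sum fun i _ => hP i i

lemma HM.smul {k : Fin 3} {f : E3 → ℝ} {d : ℝ} {P : E3 → M3} {y : E3} {A : M3} (hf : HD k f y d)
    (hP : HM k P y A) : HM k (fun z => f z • P z) y (d • P y + f y • A) := fun i j =>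
  hf.mul (hP i j)

lemma HM.csmul {k : Fin 3} (c : ℝ) {P : E3 → M3} {y : E3} {A : M3}
    (hP : HM k P y A) : HM k (fun z => c • P z) y (c • A) := fun i j => (hP i j).cmul c

lemma HM.add {k : Fin 3} {P R : E3 → M3} {y : E3} {A B : M3} (hP : HM k P y A) (hR : HM k R y B) :
    HM k (fun z => P z + R z) y (A + B) := fun i j => (hP i j).add (hR i j)

lemma HM.sub {k : Fin 3} {P R : E3 → M3} {y : E3} {A B : M3} (hP : HM k P y A) (hR : HM k R y B) :
    HM k (fun z => P z - R z) y (A - B) := fun i j => (hP i j).sub (hR i j)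

lemma HM.const (k : Fin 3) (A : M3) (y : E3) : HM k (fun _ => A) y 0 := fun i j =>
  ⟨differentiableAt_const _, D_const k _ y⟩

lemma HM.pd_eq {k : Fin 3} {P : E3 → M3} {y : E3} {A : M3} (hP : HM k P y A) : pd P k y = A := by
  ext i j; exact (hP i j).2

lemma S0_add {A B : M3} (hA : A ∈ S0) (hB : B ∈ S0) : A + B ∈ S0 :=
  ⟨hA.1.add hB.1, by rw [trace_add, hA.2, hB.2, add_zero]⟩

lemma S0_smul (t : ℝ) {A : M3} (hA : A ∈ S0) : t • A ∈ S0 :=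
  ⟨hA.1.smul t, by rw [trace_smul, hA.2, smul_zero]⟩

lemma S0_zero : (0 : M3) ∈ S0 := ⟨isSymm_zero, trace_zero _ _⟩

lemma S0_sum {A : Fin 3 → M3} (hA : ∀ k, A k ∈ S0) : ∑ k, A k ∈ S0 := by
  rw [Fin.sum_univ_three]
  exact S0_add (S0_add (hA 0) (hA 1)) (hA 2)

lemma S0_DfM (a b c : ℝ) {A : M3} (hA : A ∈ S0) : DfM a b c A ∈ S0 := by
  have h1 : Aᵀ = A := hA.1
  constructor
  · unfold DfM Matrix.IsSymm
    simp [h1]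
  · unfold DfM
    simp [hA.2]
    ring

lemma S0_pd {P : E3 → M3} (hP : SmM P) (h : ∀ y, P y ∈ S0) (k : Fin 3) (y : E3) : pd P k y ∈ S0 := by
  constructor
  · ext i j
    have : (fun z => P z j i) = fun z => P z i j := funext fun z => (h z).1.apply i j
    simp only [pd, transpose_apply, Matrix.of_apply]
    rw [this]
  · have := (hP.HM k y).trace.2
    have e : (fun z => (P z).trace) = fun _ => 0 := funext fun z => (h z).2
    rw [e, D_const] at this
    exact this.symm

lemma dot_eq (X : M3) {Y : M3} (hY : Y.IsSymm) :
    ∑ α : Fin 3 × Fin 3, X α.1 α.2 * Y α.1 α.2 = (X * Y).trace := by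
  rw [Fintype.sum_prod_type]
  unfold Matrix.trace
  refine Finset.sum_congr rfl fun i _ => ?_
  rw [diag_apply, Matrix.mul_apply]
  exact Finset.sum_congr rfl fun j _ => by rw [hY.apply]

lemma frobSq_eq {A : M3} (hA : A.IsSymm) : frobSq A = (A * A).trace := by
  rw [← dot_eq A hA, Fintype.sum_prod_type]
  unfold frobSq
  exact Finset.sum_congr rfl fun i _ => Finset.sum_congr rfl fun j _ => by ring

lemma sm_fbulk (a b c : ℝ) {P : E3 → M3} (hP : SmM P) : Sm (fun y => fbulk a b c (P y)) := by
  unfold fbulk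
  exact (((contDiff_const.sub (contDiff_const.mul (hP.mul hP).trace)).sub
    (contDiff_const.mul ((hP.mul hP).mul hP).trace))).add (contDiff_const.mul ((hP.mul hP).trace.pow 2))

lemma smM_DfM (a b c : ℝ) {P : E3 → M3} (hP : SmM P) : SmM (fun y => DfM a b c (P y)) := by
  have h1 : SmM (fun y => -(a • P y)) := fun i j => (contDiff_const.mul (hP i j)).neg
  have h2 : SmM (fun y => b • (P y * P y)) := SmM.smul contDiff_const (hP.mul hP)
  have h3 := SmM.smul (contDiff_const.mul (hP.mul hP).trace : Sm fun y => b / 3 * (P y * P y).trace)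
    (SmM.const 1)
  have h4 := SmM.smul (contDiff_const.mul (hP.mul hP).trace : Sm fun y => c * (P y * P y).trace) hP
  exact fun i j => (((h1 i j).sub (h2 i j)).add (h3 i j)).add (h4 i j)

lemma D_fbulk (a b c : ℝ) {P : E3 → M3} (hP : SmM P) (h : ∀ y, P y ∈ S0) (k : Fin 3) (y : E3) :
    D k (fun y => fbulk a b c (P y)) y = (DfM a b c (P y) * pd P k y).trace := by
  have hm := hP.HM k y
  have hA := (S0_pd hP h k y).2
  generalize pd P k y = A at *
  have h2 := (hm.mul hm).trace
  have h3 := ((hm.mul hm).mul hm).trace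
  have c0 : HD k (fun _ => kconst a b c) y 0 := ⟨differentiableAt_const _, D_const k _ y⟩
  have := (((c0.sub (h2.cmul (a / 2))).sub (h3.cmul (b / 3))).add (h2.sq.cmul (c / 4))).2
  refine Eq.trans this ?_
  unfold DfM
  simp only [add_mul, sub_mul, neg_mul, trace_add, trace_sub, trace_neg, Matrix.smul_mul, trace_smul,
    one_mul, hA, smul_eq_mul]
  have e1 : (A * P y).trace = (P y * A).trace := trace_mul_comm _ _
  have e2 : (A * P y * P y).trace = (P y * P y * A).trace := by
    rw [Matrix.mul_assoc, trace_mul_comm]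
  have e3 : (P y * A * P y).trace = (P y * P y * A).trace := by
    rw [trace_mul_comm, Matrix.mul_assoc]
  rw [e1, e2, e3]
  ring

lemma pd_DfM (a b c : ℝ) {P : E3 → M3} (hP : SmM P) (h : ∀ y, P y ∈ S0) (k : Fin 3) (y : E3) :
    (pd (fun y => DfM a b c (P y)) k y * pd P k y).trace = hessM a b c (P y) (pd P k y) := by
  have hm := hP.HM k y
  have hA := (S0_pd hP h k y).2
  generalize pd P k y = A at *
  have h2 := (hm.mul hm).trace
  have := ((((hm.csmul (-a)).sub ((hm.mul hm).csmul b)).add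
    (HM.smul (h2.cmul (b / 3)) (HM.const k 1 y))).add (HM.smul (h2.cmul c) hm)).pd_eq
  have e0 : (fun y => DfM a b c (P y)) = fun z => (-a) • P z - b • (P z * P z) +
      (b / 3 * (P z * P z).trace) • (1 : M3) + (c * (P z * P z).trace) • P z := by
    funext z; unfold DfM; rw [neg_smul]
  rw [e0, this]
  unfold hessM
  simp only [add_mul, sub_mul, trace_add, trace_sub, Matrix.smul_mul, trace_smul,
    one_mul, hA, smul_eq_mul, smul_zero]
  have e1 : (A * P y).trace = (P y * A).trace := trace_mul_comm _ _
  have e2 : (A * P y * A).trace = (P y * (A * A)).trace := by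
    rw [Matrix.mul_assoc, trace_mul_comm, Matrix.mul_assoc]
  have e3 : (P y * A * A).trace = (P y * (A * A)).trace := by rw [Matrix.mul_assoc]
  rw [e1, e2, e3]
  simp
  ring

lemma fbulk_expand (a b c t : ℝ) {X Y : M3} (hY : Y.trace = 0) :
    fbulk a b c (X + t • Y) = fbulk a b c X + t * (DfM a b c X * Y).trace
      + t ^ 2 * (1 / 2 * hessM a b c X Y)
      + t ^ 3 * (- b / 3 * (Y * Y * Y).trace + c * (X * Y).trace * (Y * Y).trace)
      + t ^ 4 * (c / 4 * (Y * Y).trace ^ 2) := by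
  unfold fbulk DfM hessM
  simp only [add_mul, mul_add, sub_mul, neg_mul, trace_add, trace_sub, trace_neg, Matrix.smul_mul,
    Matrix.mul_smul, trace_smul, one_mul, hY, smul_eq_mul]
  have e1 : (Y * X).trace = (X * Y).trace := trace_mul_comm _ _
  have e2 : (Y * X * X).trace = (X * X * Y).trace := by rw [Matrix.mul_assoc, trace_mul_comm]
  have e3 : (X * Y * X).trace = (X * X * Y).trace := by rw [trace_mul_comm, Matrix.mul_assoc]
  have e4 : (X * Y * Y).trace = (X * (Y * Y)).trace := by rw [Matrix.mul_assoc]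
  have e5 : (Y * X * Y).trace = (X * (Y * Y)).trace := by
    rw [Matrix.mul_assoc, trace_mul_comm, Matrix.mul_assoc]
  have e6 : (Y * Y * X).trace = (X * (Y * Y)).trace := trace_mul_comm _ _
  rw [e1, e2, e3, e4, e5, e6]
  ring

/-! ## The Euler-Lagrange equation -/

lemma eDen_congr {a b c ε : ℝ} {P R : E3 → M3} {U : Set E3} (hU : IsOpen U)
    (h : ∀ y ∈ U, P y = R y) {y : E3} (hy : y ∈ U) : eDen a b c ε P y = eDen a b c ε R y := by
  have hpd : ∀ k, pd P k y = pd R k y := fun k => by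
    ext i j
    exact D_congr_on hU (fun z hz => by rw [h z hz]) k hy
  unfold eDen gradSq
  simp only [hpd, h y hy]

lemma energy_congr {a b c ε : ℝ} {P R : E3 → M3} {x : E3} {r : ℝ}
    (h : ∀ y ∈ ball x r, P y = R y) : energy a b c ε P (ball x r) = energy a b c ε R (ball x r) :=
  setIntegral_congr_fun measurableSet_ball fun _ hy => eDen_congr isOpen_ball h hy

lemma sm_eDen (a b c ε : ℝ) {P : E3 → M3} (hP : SmM P) : Sm (eDen a b c ε P) := by
  unfold eDen gradSq frobSq
  exact (contDiff_const.mul (ContDiff.sum fun k _ => ContDiff.sum fun i _ => ContDiff.sum fun j _ =>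
    (hP.pd k i j).pow 2)).add (contDiff_const.mul (sm_fbulk a b c hP))

lemma frobSq_add (A B : M3) (t : ℝ) : frobSq (A + t • B) = frobSq A
    + t * (2 * ∑ α : Fin 3 × Fin 3, A α.1 α.2 * B α.1 α.2) + t ^ 2 * frobSq B := by
  rw [Fintype.sum_prod_type]
  unfold frobSq
  simp only [Finset.mul_sum, ← Finset.sum_add_distrib]
  refine Finset.sum_congr rfl fun i _ => Finset.sum_congr rfl fun j _ => ?_
  simp only [Matrix.add_apply, Matrix.smul_apply, smul_eq_mul]
  ring

lemma sm_hess (a b c : ℝ) {P R : E3 → M3} (hP : SmM P) (hR : SmM R) :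
    Sm (fun y => hessM a b c (P y) (R y)) := by
  unfold hessM
  exact ((contDiff_const.mul (hR.mul hR).trace).sub (contDiff_const.mul (hP.mul (hR.mul hR)).trace)).add
    (contDiff_const.mul ((contDiff_const.mul ((hP.mul hR).trace.pow 2)).add
      ((hP.mul hP).trace.mul (hR.mul hR).trace)))

lemma poly_min {E I1 I2 I3 I4 : ℝ}
    (h : ∀ t : ℝ, E ≤ E + t * I1 + t ^ 2 * I2 + t ^ 3 * I3 + t ^ 4 * I4) : I1 = 0 := by
  have hd : HasDerivAt (fun t : ℝ => E + t * I1 + t ^ 2 * I2 + t ^ 3 * I3 + t ^ 4 * I4) I1 0 := by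
    have h1 := ((((((hasDerivAt_id (0 : ℝ)).mul_const I1).const_add E).add
      ((hasDerivAt_pow 2 (0 : ℝ)).mul_const I2)).add ((hasDerivAt_pow 3 (0 : ℝ)).mul_const I3)).add
      ((hasDerivAt_pow 4 (0 : ℝ)).mul_const I4))
    convert! h1 using 1
    simp
  refine IsLocalMin.hasDerivAt_eq_zero ?_ hd
  refine Filter.Eventually.of_forall fun t => ?_
  simpa using h t

lemma euler_lagrange {a b c ε : ℝ} {x : E3} {r : ℝ} (hr : 0 < r) {Q P : E3 → M3}
    (hQ : ContDiffOn ℝ (⊤ : ℕ∞) Q (ball x (4 * r))) (hQS : ∀ y ∈ ball x (4 * r), Q y ∈ S0)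
    (hmin : IsLDGMin a b c ε (ball x (4 * r)) Q)
    (hP : SmM P) (hPS : ∀ y, P y ∈ S0) (hPQ : ∀ y ∈ ball x (3 * r), P y = Q y) :
    ∀ y ∈ ball x (2 * r), ∀ i j, ∑ k, D k (D k (fun z => P z i j)) y
      = 1 / ε ^ 2 * DfM a b c (P y) i j := by
  set V : E3 → M3 := fun y => (-1 : ℝ) • (∑ k, pd (pd P k) k y) + (1 / ε ^ 2) • DfM a b c (P y) with hV
  have sV : SmM V := (SmM.smul contDiff_const (SmM.sum fun k => (hP.pd k).pd k)).add
    (SmM.smul contDiff_const (smM_DfM a b c hP))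
  have VS : ∀ y, V y ∈ S0 := fun y => S0_add (S0_smul _ (S0_sum fun k =>
    S0_pd (hP.pd k) (fun z => S0_pd hP hPS k z) k y)) (S0_smul _ (S0_DfM a b c (hPS y)))
  have Vij : ∀ y i j, V y i j = -(∑ k, D k (D k (fun z => P z i j)) y)
      + 1 / ε ^ 2 * DfM a b c (P y) i j := by
    intro y i j
    simp only [hV, Matrix.add_apply, Matrix.smul_apply, Matrix.sum_apply, smul_eq_mul]
    rw [neg_one_mul]
    rfl
  let χ : ContDiffBump x := ⟨2 * r, 5 / 2 * r, by positivity, by linarith⟩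
  have sχ : Sm χ := χ.contDiff
  have χ0 : ∀ y, 5 / 2 * r < dist y x → χ y = 0 := fun y hy => χ.zero_of_le_dist hy.le
  have χ1 : ∀ y ∈ ball x (2 * r), χ y = 1 := fun y hy =>
    χ.one_of_mem_closedBall (ball_subset_closedBall hy)
  set φ : E3 → M3 := fun y => χ y • V y with hφ
  have sφ : SmM φ := SmM.smul sχ sV
  have φS : ∀ y, φ y ∈ S0 := fun y => S0_smul _ (VS y)
  have φ0 : ∀ y, 5 / 2 * r < dist y x → φ y = 0 := fun y hy => by
    simp only [hφ]; rw [χ0 y hy, zero_smul]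
  set c1 : E3 → ℝ := fun y => ∑ k, ∑ α : Fin 3 × Fin 3, pd P k y α.1 α.2 * pd φ k y α.1 α.2
    + 1 / ε ^ 2 * (DfM a b c (P y) * φ y).trace with hc1
  set c2 : E3 → ℝ := fun y => 1 / 2 * gradSq φ y + 1 / ε ^ 2 * (1 / 2 * hessM a b c (P y) (φ y)) with hc2
  set c3 : E3 → ℝ := fun y => 1 / ε ^ 2 * (- b / 3 * (φ y * φ y * φ y).trace
    + c * (P y * φ y).trace * (φ y * φ y).trace) with hc3
  set c4 : E3 → ℝ := fun y => 1 / ε ^ 2 * (c / 4 * (φ y * φ y).trace ^ 2) with hc4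
  have s1 : Sm c1 := (ContDiff.sum fun k _ => ContDiff.sum fun α _ =>
    (hP.pd k α.1 α.2).mul (sφ.pd k α.1 α.2)).add (contDiff_const.mul ((smM_DfM a b c hP).mul sφ).trace)
  have s2 : Sm c2 := by
    refine ContDiff.add (contDiff_const.mul ?_) (contDiff_const.mul (contDiff_const.mul (sm_hess a b c hP sφ)))
    unfold gradSq frobSq
    exact ContDiff.sum fun k _ => ContDiff.sum fun i _ => ContDiff.sum fun j _ => (sφ.pd k i j).pow 2
  have s3 : Sm c3 := contDiff_const.mul ((contDiff_const.mul ((sφ.mul sφ).mul sφ).trace).add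
    ((contDiff_const.mul (hP.mul sφ).trace).mul (sφ.mul sφ).trace))
  have s4 : Sm c4 := contDiff_const.mul (contDiff_const.mul ((sφ.mul sφ).trace.pow 2))
  have hexp : ∀ t y, eDen a b c ε (fun z => P z + t • φ z) y =
      eDen a b c ε P y + t * c1 y + t ^ 2 * c2 y + t ^ 3 * c3 y + t ^ 4 * c4 y := by
    intro t y
    have hp : ∀ k, pd (fun z => P z + t • φ z) k y = pd P k y + t • pd φ k y := fun k =>
      ((hP.HM k y).add ((sφ.HM k y).csmul t)).pd_eq
    simp only [eDen, gradSq, hp, frobSq_add, fbulk_expand a b c t (φS y).2, hc1, hc2, hc3, hc4,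
      Finset.sum_add_distrib, ← Finset.mul_sum]
    ring
  have hI : ∀ t : ℝ, energy a b c ε (fun z => P z + t • φ z) (ball x (3 * r)) =
      energy a b c ε P (ball x (3 * r)) + t * (∫ y in ball x (3 * r), c1 y)
      + t ^ 2 * (∫ y in ball x (3 * r), c2 y) + t ^ 3 * (∫ y in ball x (3 * r), c3 y)
      + t ^ 4 * (∫ y in ball x (3 * r), c4 y) := by
    intro t
    unfold energy
    simp only [hexp]
    have i0 := int_ball (sm_eDen a b c ε hP).cont x (3 * r)
    have i1 : IntegrableOn (fun y => t * c1 y) (ball x (3 * r)) :=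
      int_ball (continuous_const.mul s1.cont) x (3 * r)
    have i2 : IntegrableOn (fun y => t ^ 2 * c2 y) (ball x (3 * r)) :=
      int_ball (continuous_const.mul s2.cont) x (3 * r)
    have i3 : IntegrableOn (fun y => t ^ 3 * c3 y) (ball x (3 * r)) :=
      int_ball (continuous_const.mul s3.cont) x (3 * r)
    have i4 : IntegrableOn (fun y => t ^ 4 * c4 y) (ball x (3 * r)) :=
      int_ball (continuous_const.mul s4.cont) x (3 * r)
    have j1 : IntegrableOn (fun y => eDen a b c ε P y + t * c1 y) (ball x (3 * r)) := i0.add i1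
    have j2 : IntegrableOn (fun y => eDen a b c ε P y + t * c1 y + t ^ 2 * c2 y)
      (ball x (3 * r)) := j1.add i2
    have j3 : IntegrableOn (fun y => eDen a b c ε P y + t * c1 y + t ^ 2 * c2 y + t ^ 3 * c3 y)
      (ball x (3 * r)) := j2.add i3
    rw [integral_add j3 i4, integral_add j2 i3, integral_add j1 i2, integral_add i0 i1]
    simp only [integral_const_mul]
  have sT : ∀ t : ℝ, ContDiff ℝ (⊤ : ℕ∞) (fun z => t • φ z) := fun t =>
    (SmM.smul contDiff_const sφ).contDiff
  have hle : ∀ t : ℝ, energy a b c ε P (ball x (3 * r)) ≤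
      energy a b c ε (fun z => P z + t • φ z) (ball x (3 * r)) := by
    intro t
    have h := hmin x (3 * r) (by positivity) (closedBall_subset_ball (by linarith))
      (fun z => Q z + t • φ z) (hQ.add (sT t).contDiffOn)
      (fun y hy => S0_add (hQS y hy) (S0_smul t (φS y)))
      ⟨closedBall x (5 / 2 * r), isCompact_closedBall _ _, closedBall_subset_ball (by linarith),
        fun y hy => by
          rw [mem_closedBall, not_le] at hy
          rw [φ0 y hy, smul_zero, add_zero]⟩
    rw [energy_congr hPQ, energy_congr (P := fun z => P z + t • φ z)
      (R := fun z => Q z + t • φ z) (fun y hy => by rw [hPQ y hy])]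
    exact h
  have hI1 : ∫ y in ball x (3 * r), c1 y = 0 :=
    poly_min fun t => (hle t).trans (le_of_eq (hI t))
  have hpd0 : ∀ k y, 5 / 2 * r < dist y x → pd φ k y = 0 := fun k y hy => by
    ext i j
    exact D_zero_of_zero (u := fun z => φ z i j) (fun z hz => by rw [φ0 z hz]; rfl) k y hy
  have hI2 : ∫ y, c1 y = 0 := by
    rw [← hI1]
    refine (setIntegral_eq_integral_of_forall_compl_eq_zero fun y hy => ?_).symm
    have hd : 5 / 2 * r < dist y x := by
      rw [mem_ball, not_lt] at hy; linarith
    simp only [hc1, hpd0 _ y hd, φ0 y hd]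
    simp
  set W : Fin 3 → Fin 3 × Fin 3 → E3 → ℝ := fun k α y => pd P k y α.1 α.2 * φ y α.1 α.2 with hW
  have sW : ∀ k α, Sm (W k α) := fun k α => (hP.pd k α.1 α.2).mul (sφ α.1 α.2)
  have zW : ∀ k α y, 5 / 2 * r < dist y x → W k α y = 0 := fun k α y hy => by
    simp only [hW, φ0 y hy]; simp
  have iW : ∀ k α, Integrable (fun y => D k (W k α) y) := fun k α =>
    int_cs ((sW k α).D k).cont (cs_of_zero (D_zero_of_zero (zW k α) k))
  have hWint : ∫ y, ∑ k, ∑ α, D k (W k α) y = 0 := by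
    rw [integral_finsetSum _ (fun k _ => integrable_finsetSum _ fun α _ => iW k α)]
    refine Finset.sum_eq_zero fun k _ => ?_
    rw [integral_finsetSum _ (fun α _ => iW k α)]
    exact Finset.sum_eq_zero fun α _ => int_D (sW k α) (zW k α) k
  set S : E3 → ℝ := fun y => χ y * ∑ α : Fin 3 × Fin 3, V y α.1 α.2 ^ 2 with hS
  have cS : Continuous S := by
    have : Sm S := sχ.mul (ContDiff.sum fun α _ => (sV α.1 α.2).pow 2)
    exact this.cont
  have hSeq : ∀ y, S y = c1 y - ∑ k, ∑ α, D k (W k α) y := by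
    intro y
    have e1 : ∀ k α, D k (W k α) y = D k (D k (fun z => P z α.1 α.2)) y * φ y α.1 α.2
        + pd P k y α.1 α.2 * pd φ k y α.1 α.2 := fun k α =>
      ((HD.of (k := k) (hP.pd k α.1 α.2) y).mul (HD.of (k := k) (sφ α.1 α.2) y)).2
    simp only [e1, hc1, Finset.sum_add_distrib]
    rw [← dot_eq _ (φS y).1, Finset.sum_comm (f := fun k (α : Fin 3 × Fin 3) =>
      D k (D k (fun z => P z α.1 α.2)) y * φ y α.1 α.2)]
    simp only [← Finset.sum_mul]
    have e2 : S y = ∑ α : Fin 3 × Fin 3, V y α.1 α.2 * φ y α.1 α.2 := by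
      simp only [hS, Finset.mul_sum]
      refine Finset.sum_congr rfl fun α _ => ?_
      simp only [hφ, Matrix.smul_apply, smul_eq_mul]
      ring
    rw [e2]
    simp only [Vij, add_mul, Finset.sum_add_distrib, neg_mul, Finset.sum_neg_distrib, Finset.mul_sum]
    simp only [mul_assoc]
    ring
  have hc1i : Integrable c1 := int_cs s1.cont (cs_of_zero (x := x) (R := 5 / 2 * r) fun y hd => by
    simp only [hc1, hpd0 _ y hd, φ0 y hd]
    simp)
  have hWi : Integrable (fun y => ∑ k, ∑ α, D k (W k α) y) :=
    integrable_finsetSum _ fun k _ => integrable_finsetSum _ fun α _ => iW k α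
  have hSf : S = fun y => c1 y - ∑ k, ∑ α, D k (W k α) y := funext hSeq
  have iS : Integrable S := by rw [hSf]; exact hc1i.sub hWi
  have hSint : ∫ y, S y = 0 := by
    rw [hSf, integral_sub hc1i hWi, hI2, hWint, sub_zero]
  have hSnn : 0 ≤ S := fun y => mul_nonneg χ.nonneg (by positivity)
  have hS0 : S = fun _ => 0 := by
    have := (integral_eq_zero_iff_of_nonneg hSnn iS).1 hSint
    exact (Continuous.ae_eq_iff_eq volume cS continuous_const).1 this
  intro y hy i j
  have h1 : S y = 0 := by rw [hS0]
  simp only [hS, χ1 y hy, one_mul] at h1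
  have h2 := (Finset.sum_eq_zero_iff_of_nonneg (fun α _ => sq_nonneg _)).1 h1 (i, j) (Finset.mem_univ _)
  have h3 : V y i j = 0 := pow_eq_zero_iff (two_ne_zero) |>.1 h2
  rw [Vij] at h3
  linarith

/-! ## Conclusion -/

lemma exists_ext {x : E3} {r : ℝ} (hr : 0 < r) {Q : E3 → M3}
    (hQ : ContDiffOn ℝ (⊤ : ℕ∞) Q (ball x (4 * r))) (hQS : ∀ y ∈ ball x (4 * r), Q y ∈ S0) :
    ∃ P : E3 → M3, SmM P ∧ (∀ y, P y ∈ S0) ∧ ∀ y ∈ ball x (3 * r), P y = Q y := by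
  let χ : ContDiffBump x := ⟨3 * r, 7 / 2 * r, by positivity, by linarith⟩
  have sχ : Sm χ := χ.contDiff
  have χ0 : ∀ y, 7 / 2 * r ≤ dist y x → χ y = 0 := fun y hy => χ.zero_of_le_dist hy
  refine ⟨fun y => χ y • Q y, fun i j => ?_, fun y => ?_, fun y hy => ?_⟩
  · rw [Sm, contDiff_iff_contDiffAt]
    intro y
    by_cases hy : y ∈ ball x (4 * r)
    · have h1 : ContDiffAt ℝ (⊤ : ℕ∞) Q y := hQ.contDiffAt (isOpen_ball.mem_nhds hy)
      have h2 : ContDiffAt ℝ (⊤ : ℕ∞) (fun z => Q z i j) y :=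
        contDiffAt_pi.1 (contDiffAt_pi.1 h1 i) j
      exact (sχ.contDiffAt).mul h2
    · have hm : {z | 7 / 2 * r < dist z x} ∈ nhds y := by
        refine (isOpen_lt continuous_const (continuous_id.dist continuous_const)).mem_nhds ?_
        rw [mem_ball, not_lt] at hy
        show 7 / 2 * r < dist y x
        linarith
      refine (contDiffAt_const (c := (0 : ℝ))).congr_of_eventuallyEq ?_
      filter_upwards [hm] with z hz
      have hz' : 7 / 2 * r < dist z x := hz
      simp only [χ0 z hz'.le, zero_smul]
      rfl
  · by_cases hy : y ∈ ball x (4 * r)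
    · exact S0_smul _ (hQS y hy)
    · rw [mem_ball, not_lt] at hy
      simp only [χ0 y (by linarith), zero_smul]
      exact S0_zero
  · have : χ y = 1 := χ.one_of_mem_closedBall (ball_subset_closedBall hy)
    simp only [this, one_smul]

lemma quad_bound {C γ F n : ℝ} (hC : 0 ≤ C) (hF : 0 ≤ F) (hn : 0 ≤ n) :
    -((4 * C ^ 2 + 4 * C) * (1 / 2 * n + F) ^ 2) ≤ γ ^ 2 + 2 * (-(C * (γ + F) * n)) := by
  have h1 : 0 ≤ C * n ^ 2 := by positivity
  have h2 : 0 ≤ C * F ^ 2 := by positivity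
  have h3 : 0 ≤ C * (n * F) := by positivity
  have h4 : 0 ≤ C ^ 2 * (n * F) := by positivity
  have h5 : 0 ≤ C ^ 2 * F ^ 2 := by positivity
  nlinarith [sq_nonneg (γ - C * n)]

lemma eA_eq (a b c ε : ℝ) (P : E3 → M3) (y : E3) :
    eA (fun (α : Fin 3 × Fin 3) z => P z α.1 α.2) (fun z => 1 / ε ^ 2 * fbulk a b c (P z)) y
      = eDen a b c ε P y := by
  unfold eA eDen gradSq frobSq
  congr 1
  rw [← Finset.mul_sum, Finset.sum_comm]
  congr 1
  refine Finset.sum_congr rfl fun k _ => ?_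
  rw [Fintype.sum_prod_type]
  rfl

lemma stmt6_aux (a b c : ℝ) (ha : 0 ≤ a) (hb : 0 < b) (hc : 0 < c)
    (M θ : ℝ) (hθ : 0 < θ) :
    ∃ η : ℝ, 0 < η ∧
      ∀ ε : ℝ, 0 < ε → ∀ (x : E3) (r : ℝ), 0 < r →
        ∀ Q : E3 → M3,
          ContDiffOn ℝ (⊤ : ℕ∞) Q (ball x (4 * r)) →
          (∀ y ∈ ball x (4 * r), Q y ∈ S0) →
          IsLDGMin a b c ε (ball x (4 * r)) Q →
          (∀ y ∈ ball x (4 * r), frobNorm (Q y) ≤ M) →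
          r⁻¹ * energy a b c ε Q (ball x (2 * r)) < η →
          ∀ y ∈ ball x r, r ^ 2 * eDen a b c ε Q y ≤ θ := by
  obtain ⟨C, hC, H⟩ := hess_lower ha hb hc M
  obtain ⟨η, hη, HS⟩ := schoen (4 * C ^ 2 + 4 * C) θ (by positivity) hθ
  refine ⟨η, hη, ?_⟩
  intro ε hε x r hr Q hQ hQS hmin hbd hen
  obtain ⟨P, sP, PS, PQ⟩ := exists_ext hr hQ hQS
  have EL := euler_lagrange hr hQ hQS hmin sP PS PQ
  have PQ2 : ∀ y ∈ ball x (2 * r), P y = Q y := fun y hy =>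
    PQ y (ball_subset_ball (by linarith) hy)
  have PM : ∀ y ∈ ball x (2 * r), (P y * P y).trace ≤ M ^ 2 := by
    intro y hy
    rw [← frobSq_eq (PS y).1, PQ2 y hy]
    have h0 : 0 ≤ frobSq (Q y) := by unfold frobSq; positivity
    have h := hbd y (ball_subset_ball (by linarith) hy)
    rw [← Real.sq_sqrt h0]
    exact pow_le_pow_left₀ (Real.sqrt_nonneg _) h 2
  have hε2 : 0 < 1 / ε ^ 2 := by positivity
  have key := HS (ι := Fin 3 × Fin 3) (fun α z => P z α.1 α.2)
    (fun α z => 1 / ε ^ 2 * DfM a b c (P z) α.1 α.2) (fun z => 1 / ε ^ 2 * fbulk a b c (P z))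
    (fun α => sP α.1 α.2) (contDiff_const.mul (sm_fbulk a b c sP))
    (fun α => contDiff_const.mul (smM_DfM a b c sP α.1 α.2)) x r hr
    (fun y hy α => EL y hy α.1 α.2)
    (fun y hy k => by
      have h1 : D k (fun z => 1 / ε ^ 2 * fbulk a b c (P z)) y
          = 1 / ε ^ 2 * D k (fun z => fbulk a b c (P z)) y :=
        (HD.cmul (1 / ε ^ 2) (HD.of (k := k) (sm_fbulk a b c sP) y)).2
      rw [h1, D_fbulk a b c sP PS k y, ← dot_eq _ (S0_pd sP PS k y).1, Finset.mul_sum]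
      refine Finset.sum_congr rfl fun α _ => ?_
      rw [← mul_assoc]
      rfl)
    (fun y hy => mul_nonneg hε2.le (fbulk_nonneg ha hb hc (PS y)))
    (fun y hy => by
      have GS := S0_DfM a b c (PS y)
      rw [eA_eq]
      have e1 : ∑ α : Fin 3 × Fin 3, (1 / ε ^ 2 * DfM a b c (P y) α.1 α.2) ^ 2
          = (1 / ε ^ 2 * Real.sqrt (DfM a b c (P y) * DfM a b c (P y)).trace) ^ 2 := by
        have h0 : 0 ≤ (DfM a b c (P y) * DfM a b c (P y)).trace := by
          rw [← frobSq_eq GS.1]; unfold frobSq; positivity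
        rw [mul_pow, Real.sq_sqrt h0, ← dot_eq _ GS.1, Finset.mul_sum]
        refine Finset.sum_congr rfl fun α _ => ?_
        ring
      have e2 : ∑ α : Fin 3 × Fin 3, ∑ k, D k (fun z => 1 / ε ^ 2 * DfM a b c (P z) α.1 α.2) y
          * D k (fun z => P z α.1 α.2) y
          = 1 / ε ^ 2 * ∑ k, hessM a b c (P y) (pd P k y) := by
        rw [Finset.sum_comm, Finset.mul_sum]
        refine Finset.sum_congr rfl fun k _ => ?_
        rw [← pd_DfM a b c sP PS k y, ← dot_eq _ (S0_pd sP PS k y).1, Finset.mul_sum]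
        refine Finset.sum_congr rfl fun α _ => ?_
        have h1 : D k (fun z => 1 / ε ^ 2 * DfM a b c (P z) α.1 α.2) y
            = 1 / ε ^ 2 * D k (fun z => DfM a b c (P z) α.1 α.2) y :=
          (HD.cmul (1 / ε ^ 2) (HD.of (k := k) (smM_DfM a b c sP α.1 α.2) y)).2
        rw [h1, mul_assoc]
        rfl
      have e3 : -(C * (Real.sqrt (DfM a b c (P y) * DfM a b c (P y)).trace + fbulk a b c (P y))
          * gradSq P y) ≤ ∑ k, hessM a b c (P y) (pd P k y) := by
        unfold gradSq
        rw [Finset.mul_sum, ← Finset.sum_neg_distrib]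
        refine Finset.sum_le_sum fun k _ => ?_
        rw [frobSq_eq (S0_pd sP PS k y).1]
        exact H (P y) (PS y) (PM y hy) _ (S0_pd sP PS k y)
      have e4 := mul_le_mul_of_nonneg_left e3 hε2.le
      have hn : 0 ≤ gradSq P y := by unfold gradSq frobSq; positivity
      have hq := quad_bound (C := C) (n := gradSq P y)
        (γ := 1 / ε ^ 2 * Real.sqrt (DfM a b c (P y) * DfM a b c (P y)).trace)
        (F := 1 / ε ^ 2 * fbulk a b c (P y)) hC
        (mul_nonneg hε2.le (fbulk_nonneg ha hb hc (PS y))) hn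
      simp only [e1, e2]
      unfold eDen
      refine hq.trans ?_
      have e5 : -(C * (1 / ε ^ 2 * Real.sqrt (DfM a b c (P y) * DfM a b c (P y)).trace
          + 1 / ε ^ 2 * fbulk a b c (P y)) * gradSq P y) = 1 / ε ^ 2 *
          -(C * (Real.sqrt (DfM a b c (P y) * DfM a b c (P y)).trace + fbulk a b c (P y))
          * gradSq P y) := by ring
      rw [e5]
      linarith)
    (by
      simp only [eA_eq]
      have : ∫ y in ball x (2 * r), eDen a b c ε P y = energy a b c ε Q (ball x (2 * r)) :=
        energy_congr PQ2
      rw [this]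
      exact hen)
  intro y hy
  have h := key y hy
  rw [eA_eq, eDen_congr isOpen_ball PQ2 (ball_subset_ball (by linarith) hy)] at h
  exact h

/-- small energy implies a pointwise bound on the energy density. -/
theorem stmt6 (a b c : ℝ) (ha : 0 ≤ a) (hb : 0 < b) (hc : 0 < c)
    (M θ : ℝ) (hM : 0 < M) (hθ : 0 < θ) :
    ∃ η Λ : ℝ, 0 < η ∧ 0 < Λ ∧
      ∀ ε ∈ Ioo (0 : ℝ) 1, ∀ (x : E3) (r : ℝ), Λ * ε < r → r < 1 →
        ∀ Q : E3 → M3,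
          ContDiffOn ℝ (⊤ : ℕ∞) Q (ball x (4 * r)) →
          (∀ y ∈ ball x (4 * r), Q y ∈ S0) →
          IsLDGMin a b c ε (ball x (4 * r)) Q →
          (∀ y ∈ ball x (4 * r), frobNorm (Q y) ≤ M) →
          r⁻¹ * energy a b c ε Q (ball x (2 * r)) < η →
          ∀ y ∈ ball x r, r ^ 2 * eDen a b c ε Q y ≤ θ := by
  obtain ⟨η, hη, H⟩ := stmt6_aux a b c ha hb hc M θ hθ
  refine ⟨η, 1, hη, one_pos, fun ε hε x r h1 _ Q => ?_⟩
  exact H ε hε.1 x r (by have := hε.1; linarith) Q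

end
end

section
/- There is no continuous map Q from the closed unit ball of ℝ³ to the vacuum manifold N such that Q(x) = s_*( x⊗x − (1/3)I ) for every x in the unit sphere ∂B₁ (where x⊗x denotes the rank-one matrix with entries x_i x_j). -/
noncomputable section

open Matrix MeasureTheory Metric Set

attribute [local instance] Matrix.normedAddCommGroup Matrix.normedSpace

/-- matrix entries of a linear map -/
def ent (i j : Fin 3) (L : E3 →L[ℝ] E3) : ℝ := (L (EuclideanSpace.single j 1)) i

lemma ent_continuous (i j : Fin 3) : Continuous (ent i j) := by
  unfold ent
  fun_prop

def co1 (L : E3 →L[ℝ] E3) : ℝ := ent 0 0 L + ent 1 1 L + ent 2 2 L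
def co2 (L : E3 →L[ℝ] E3) : ℝ :=
  ent 0 0 L * ent 1 1 L - ent 0 1 L * ent 1 0 L + (ent 0 0 L * ent 2 2 L - ent 0 2 L * ent 2 0 L)
   + (ent 1 1 L * ent 2 2 L - ent 1 2 L * ent 2 1 L)
def co3 (L : E3 →L[ℝ] E3) : ℝ :=
  ent 0 0 L * ent 1 1 L * ent 2 2 L - ent 0 0 L * ent 1 2 L * ent 2 1 L
  - ent 0 1 L * ent 1 0 L * ent 2 2 L + ent 0 1 L * ent 1 2 L * ent 2 0 L
  + ent 0 2 L * ent 1 0 L * ent 2 1 L - ent 0 2 L * ent 1 1 L * ent 2 0 L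

lemma co1_cont : Continuous co1 := by
  unfold co1
  have := ent_continuous
  fun_prop
lemma co2_cont : Continuous co2 := by
  unfold co2
  have := ent_continuous
  fun_prop
lemma co3_cont : Continuous co3 := by
  unfold co3
  have := ent_continuous
  fun_prop

lemma det_expand (L : E3 →L[ℝ] E3) (t : ℝ) :
    (ContinuousLinearMap.id ℝ E3 + t • L).det = 1 + t * co1 L + t ^ 2 * co2 L + t ^ 3 * co3 L := by
  rw [ContinuousLinearMap.det,
    ← LinearMap.det_toMatrix (EuclideanSpace.basisFun (Fin 3) ℝ).toBasis, Matrix.det_fin_three]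
  simp [LinearMap.toMatrix_apply, co1, co2, co3, ent]
  ring

lemma lipschitz_zero_ext (g : E3 → E3) (hg : ContDiff ℝ 1 g)
    (h0 : ∀ x ∈ sphere (0 : E3) 1, g x = 0) :
    ∃ K : NNReal, LipschitzWith K (fun x => if ‖x‖ ≤ 1 then g x else 0) := by
  obtain ⟨C, hC⟩ := (isCompact_closedBall (0 : E3) 1).exists_bound_of_continuousOn
    (hg.continuous_fderiv one_ne_zero).continuousOn
  have hL : LipschitzOnWith C.toNNReal g (closedBall (0 : E3) 1) := by
    apply (convex_closedBall (0 : E3) 1).lipschitzOnWith_of_nnnorm_fderiv_le (𝕜 := ℝ)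
    · intro x _
      exact hg.differentiable one_ne_zero x
    · intro x hx
      rw [← NNReal.coe_le_coe]
      simpa using Or.inl (hC x hx)
  have hC0 : (0 : ℝ) ≤ (C.toNNReal : ℝ) := NNReal.coe_nonneg _
  have key : ∀ x y : E3, ‖x‖ ≤ 1 → 1 < ‖y‖ → ‖g x‖ ≤ C.toNNReal * ‖x - y‖ := by
    intro x y hx hy
    have hcont : ContinuousOn (fun s : ℝ => ‖x + s • (y - x)‖) (Icc 0 1) := by fun_prop
    have := intermediate_value_Icc (zero_le_one (α := ℝ)) hcont
    have h1 : (1 : ℝ) ∈ Icc ‖x + (0 : ℝ) • (y - x)‖ ‖x + (1 : ℝ) • (y - x)‖ := by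
      simp [hx, hy.le]
    obtain ⟨s, hs, hs1⟩ := this h1
    have hz := hL.dist_le_mul x (by simpa using hx) (x + s • (y - x)) (by simp at hs1; simp [hs1])
    rw [h0 (x + s • (y - x)) (by simpa using hs1)] at hz
    rw [dist_zero_right, dist_eq_norm] at hz
    refine hz.trans (mul_le_mul_of_nonneg_left ?_ hC0)
    have : x - (x + s • (y - x)) = s • (x - y) := by module
    rw [this, norm_smul, Real.norm_of_nonneg hs.1]
    exact mul_le_of_le_one_left (norm_nonneg _) hs.2
  refine ⟨C.toNNReal, LipschitzWith.of_dist_le_mul fun x y => ?_⟩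
  rw [dist_eq_norm, dist_eq_norm]
  by_cases hx : ‖x‖ ≤ 1 <;> by_cases hy : ‖y‖ ≤ 1
  · simp only [hx, hy, if_true]
    have := hL.dist_le_mul x (by simpa using hx) y (by simpa using hy)
    simpa [dist_eq_norm] using this
  · simp only [hx, hy, if_true, if_false, sub_zero]
    exact key x y hx (not_le.mp hy)
  · simp only [hx, hy, if_true, if_false, zero_sub, norm_neg]
    rw [norm_sub_rev]
    exact key y x hy (not_le.mp hx)
  · simp only [hx, hy, if_false, sub_zero, norm_zero]
    positivity

lemma image_ball (G : E3 → E3) (K : NNReal) (hG : LipschitzWith K G)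
    (h0 : ∀ x, 1 ≤ ‖x‖ → G x = 0) (t : ℝ) (ht : 0 ≤ t) (htK : t * K < 1) :
    Function.Injective (fun x => x + t • G x) ∧
      (fun x => x + t • G x) '' ball (0 : E3) 1 = ball 0 1 := by
  have hA : ApproximatesLinearOn (fun x => x + t • G x)
      ((ContinuousLinearEquiv.refl ℝ E3 : E3 ≃L[ℝ] E3) : E3 →L[ℝ] E3) univ (t.toNNReal * K) := by
    intro x _ y _
    have : (fun x => x + t • G x) x - (fun x => x + t • G x) y -
      ((ContinuousLinearEquiv.refl ℝ E3 : E3 ≃L[ℝ] E3) : E3 →L[ℝ] E3) (x - y) = t • (G x - G y) := by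
      simp; module
    rw [this, norm_smul, Real.norm_of_nonneg ht]
    have := hG.dist_le_mul x y
    rw [dist_eq_norm, dist_eq_norm] at this
    push_cast
    rw [Real.coe_toNNReal _ ht, mul_assoc]
    exact mul_le_mul_of_nonneg_left this ht
  have hc : Subsingleton E3 ∨ t.toNNReal * K <
      ‖((ContinuousLinearEquiv.refl ℝ E3).symm : E3 →L[ℝ] E3)‖₊⁻¹ := by
    right
    have : ‖((ContinuousLinearEquiv.refl ℝ E3).symm : E3 →L[ℝ] E3)‖₊ = 1 := by
      rw [← NNReal.coe_inj]
      exact ContinuousLinearMap.norm_id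
    rw [this, ← NNReal.coe_lt_coe]
    simpa [ht] using htK
  have hinj : Function.Injective (fun x => x + t • G x) := by
    have := hA.injOn hc
    rwa [injOn_univ] at this
  have hsurj : Function.Surjective (fun x => x + t • G x) := hA.surjective hc
  have hout : ∀ x, 1 ≤ ‖x‖ → x + t • G x = x := fun x hx => by simp [h0 x hx]
  refine ⟨hinj, ?_⟩
  ext y
  constructor
  · rintro ⟨x, hx, rfl⟩
    by_contra hy
    have hy' : 1 ≤ ‖x + t • G x‖ := by simpa using hy
    have := hinj (a₁ := x + t • G x) (a₂ := x) (hout _ hy')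
    rw [this] at hy'
    exact not_lt.mpr hy' (by simpa using hx)
  · intro hy
    obtain ⟨x, rfl⟩ := hsurj y
    refine ⟨x, ?_, rfl⟩
    by_contra hx
    have hx' : 1 ≤ ‖x‖ := by simpa using hx
    simp only [hout x hx'] at hy
    exact hx hy

lemma no_smooth_retraction (F : E3 → E3) (hF : ContDiff ℝ 1 F) (h1 : ∀ x, ‖F x‖ = 1)
    (h2 : ∀ x ∈ sphere (0 : E3) 1, F x = x) : False := by
  set g : E3 → E3 := fun x => F x - x with hgdef
  have hg : ContDiff ℝ 1 g := hF.sub contDiff_id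
  have hg0 : ∀ x ∈ sphere (0 : E3) 1, g x = 0 := fun x hx => by simp [hgdef, h2 x hx]
  obtain ⟨K, hK⟩ := lipschitz_zero_ext g hg hg0
  set G : E3 → E3 := fun x => if ‖x‖ ≤ 1 then g x else 0 with hG
  have hG0 : ∀ x, 1 ≤ ‖x‖ → G x = 0 := by
    intro x hx
    simp only [hG]
    split_ifs with h
    · exact hg0 x (by simpa using le_antisymm h hx)
    · rfl
  have hfc : Continuous (fderiv ℝ g) := hg.continuous_fderiv one_ne_zero
  have hint : ∀ u : E3 → ℝ, Continuous u → IntegrableOn u (ball (0 : E3) 1) := fun u hu =>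
    (hu.continuousOn.integrableOn_compact (isCompact_closedBall (0 : E3) 1)).mono_set
      ball_subset_closedBall
  have hc1 := co1_cont.comp hfc
  have hc2 := co2_cont.comp hfc
  have hc3 := co3_cont.comp hfc
  obtain ⟨C1, hC1⟩ := (isCompact_closedBall (0 : E3) 1).exists_bound_of_continuousOn hc1.continuousOn
  obtain ⟨C2, hC2⟩ := (isCompact_closedBall (0 : E3) 1).exists_bound_of_continuousOn hc2.continuousOn
  obtain ⟨C3, hC3⟩ := (isCompact_closedBall (0 : E3) 1).exists_bound_of_continuousOn hc3.continuousOn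
  set V : ℝ := ∫ x in ball (0 : E3) 1, (1 : ℝ) with hV
  set I1 : ℝ := ∫ x in ball (0 : E3) 1, co1 (fderiv ℝ g x) with hI1
  set I2 : ℝ := ∫ x in ball (0 : E3) 1, co2 (fderiv ℝ g x) with hI2
  set I3 : ℝ := ∫ x in ball (0 : E3) 1, co3 (fderiv ℝ g x) with hI3
  have hVpos : 0 < V := by
    simp only [hV, integral_const, smul_eq_mul, mul_one]
    rw [measureReal_restrict_apply_univ]
    exact ENNReal.toReal_pos (measure_ball_pos _ _ one_pos).ne' measure_ball_lt_top.ne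
  have hpoly : ∀ t : ℝ, ∫ x in ball (0 : E3) 1, (ContinuousLinearMap.id ℝ E3 + t • fderiv ℝ g x).det
      = V + t * I1 + t ^ 2 * I2 + t ^ 3 * I3 := by
    intro t
    simp only [det_expand]
    have i1 : IntegrableOn (fun x => t * co1 (fderiv ℝ g x)) (ball (0 : E3) 1) := (hint _ hc1).const_mul t
    have i2 : IntegrableOn (fun x => t ^ 2 * co2 (fderiv ℝ g x)) (ball (0 : E3) 1) :=
      (hint _ hc2).const_mul (t ^ 2)
    have i3 : IntegrableOn (fun x => t ^ 3 * co3 (fderiv ℝ g x)) (ball (0 : E3) 1) :=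
      (hint _ hc3).const_mul (t ^ 3)
    have i0 : IntegrableOn (fun _ : E3 => (1 : ℝ)) (ball (0 : E3) 1) := hint _ continuous_const
    have j1 : IntegrableOn (fun x => 1 + t * co1 (fderiv ℝ g x)) (ball (0 : E3) 1) := i0.add i1
    have j2 : IntegrableOn (fun x => 1 + t * co1 (fderiv ℝ g x) + t ^ 2 * co2 (fderiv ℝ g x))
      (ball (0 : E3) 1) := j1.add i2
    rw [integral_add j2 i3, integral_add j1 i2, integral_add i0 i1,
      integral_const_mul, integral_const_mul, integral_const_mul]
  have hsmall : ∀ t : ℝ, 0 ≤ t → t ≤ 1 → t * K < 1 → t * (|C1| + |C2| + |C3|) < 1 →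
      V + t * I1 + t ^ 2 * I2 + t ^ 3 * I3 = V := by
    intro t ht ht1 htK htC
    obtain ⟨hinj, himg⟩ := image_ball G K hK hG0 t ht htK
    rw [← hpoly]
    have hder : ∀ x ∈ ball (0 : E3) 1, HasFDerivWithinAt (fun x => x + t • G x)
        (ContinuousLinearMap.id ℝ E3 + t • fderiv ℝ g x) (ball (0 : E3) 1) x := by
      intro x hx
      have hd : HasFDerivAt (fun x => x + t • g x)
          (ContinuousLinearMap.id ℝ E3 + t • fderiv ℝ g x) x :=
        (hasFDerivAt_id x).add
          (((hg.differentiable one_ne_zero) x).hasFDerivAt.const_smul t)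
      refine hd.hasFDerivWithinAt.congr ?_ ?_
      · intro y hy
        have : ‖y‖ ≤ 1 := by simpa using (mem_ball_zero_iff.mp hy).le
        simp [hG, this]
      · have : ‖x‖ ≤ 1 := by simpa using (mem_ball_zero_iff.mp hx).le
        simp [hG, this]
    have := integral_image_eq_integral_abs_det_fderiv_smul volume measurableSet_ball hder
      hinj.injOn (fun _ => (1 : ℝ))
    rw [himg, ← hV] at this
    rw [this]
    refine setIntegral_congr_fun measurableSet_ball ?_
    intro x hx
    have hx' := ball_subset_closedBall hx
    have b1 := (hC1 x hx').trans (le_abs_self C1)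
    have b2 := (hC2 x hx').trans (le_abs_self C2)
    have b3 := (hC3 x hx').trans (le_abs_self C3)
    simp only [Function.comp, Real.norm_eq_abs] at b1 b2 b3
    have hpos : 0 ≤ (ContinuousLinearMap.id ℝ E3 + t • fderiv ℝ g x).det := by
      rw [det_expand]
      have a1 : t * -|C1| ≤ t * co1 (fderiv ℝ g x) :=
        mul_le_mul_of_nonneg_left (neg_le_of_abs_le b1) ht
      have a2 : t ^ 2 * -|C2| ≤ t ^ 2 * co2 (fderiv ℝ g x) :=
        mul_le_mul_of_nonneg_left (neg_le_of_abs_le b2) (by positivity)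
      have a3 : t ^ 3 * -|C3| ≤ t ^ 3 * co3 (fderiv ℝ g x) :=
        mul_le_mul_of_nonneg_left (neg_le_of_abs_le b3) (by positivity)
      have t2 : t ^ 2 ≤ t := by nlinarith
      have t3 : t ^ 3 ≤ t := by nlinarith
      have a4 := mul_le_mul_of_nonneg_right t2 (abs_nonneg C2)
      have a5 := mul_le_mul_of_nonneg_right t3 (abs_nonneg C3)
      nlinarith
    simp [abs_of_nonneg hpos]
  have hone : V + I1 + I2 + I3 = 0 := by
    have := hpoly 1
    simp only [one_mul, one_pow] at this
    rw [← this]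
    apply setIntegral_eq_zero_of_forall_eq_zero
    intro x _
    have hgF : ContinuousLinearMap.id ℝ E3 + (1 : ℝ) • fderiv ℝ g x = fderiv ℝ F x := by
      have : fderiv ℝ g x = fderiv ℝ F x - ContinuousLinearMap.id ℝ E3 := by
        rw [hgdef, fderiv_fun_sub (hF.differentiable one_ne_zero x) differentiableAt_fun_id]
        simp
      rw [this]; simp
    rw [hgF]
    by_contra hdet
    have hu : IsUnit (LinearMap.det ((fderiv ℝ F x : E3 →L[ℝ] E3) : E3 →ₗ[ℝ] E3)) :=
      isUnit_iff_ne_zero.mpr hdet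
    obtain ⟨v, hv⟩ := ((LinearMap.isUnit_iff_range_eq_top _).mp
      ((LinearMap.isUnit_iff_isUnit_det _).mpr hu)).symm ▸ (Submodule.mem_top : F x ∈ (⊤ : Submodule ℝ E3))
    have hd := (hF.differentiable one_ne_zero x).hasFDerivAt
    have hi := hd.inner ℝ hd
    have hconst : (fun y => inner ℝ (F y) (F y)) = fun _ : E3 => (1 : ℝ) := by
      funext y; rw [real_inner_self_eq_norm_sq, h1]; norm_num
    rw [hconst] at hi
    have hz := hi.unique (hasFDerivAt_const (1 : ℝ) x)
    have hz' := congrArg (fun L => L v) hz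
    have hv' : fderiv ℝ F x v = F x := hv
    simp [hv', h1] at hz'
  set D : ℝ := 1 + K + (|C1| + |C2| + |C3|) with hD
  have hKn : (0 : ℝ) ≤ K := K.2
  have hCn : 0 ≤ |C1| + |C2| + |C3| := by positivity
  have hDpos : 0 < D := by positivity
  have hs : ∀ k : ℝ, 2 ≤ k → I1 * (k * D) ^ 2 + I2 * (k * D) + I3 = 0 := by
    intro k hk
    have hkD : 0 < k * D := by positivity
    have hkD2 : D < k * D := by nlinarith
    have h := hsmall (1 / (k * D)) (by positivity)
      (by rw [div_le_one hkD]; linarith) (by rw [div_mul_eq_mul_div, div_lt_one hkD]; linarith)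
      (by rw [div_mul_eq_mul_div, div_lt_one hkD]; linarith)
    field_simp at h
    nlinarith
  have e2 := hs 2 le_rfl
  have e3 := hs 3 (by norm_num)
  have e4 := hs 4 (by norm_num)
  have z1 : I1 = 0 := by
    have : I1 * D ^ 2 = 0 := by linarith
    exact (mul_eq_zero.mp this).resolve_right (by positivity)
  have z2 : I2 = 0 := by
    rw [z1] at e2 e3
    have : I2 * D = 0 := by linarith
    exact (mul_eq_zero.mp this).resolve_right hDpos.ne'
  rw [z1, z2] at e2 hone
  linarith

lemma no_retraction (r : E3 → E3) (hr : ContinuousOn r (closedBall 0 1))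
    (h1 : ∀ x ∈ closedBall (0 : E3) 1, ‖r x‖ = 1)
    (h2 : ∀ x ∈ sphere (0 : E3) 1, r x = x) : False := by
  set R : E3 → E3 := fun x => if ‖x‖ ≤ 1 / 2 then r ((2 : ℝ) • x) else ‖x‖⁻¹ • x with hR
  have hRc : Continuous R := by
    apply continuous_if_le continuous_norm continuous_const
    · apply hr.comp (by fun_prop)
      intro x hx
      have hx' : ‖x‖ ≤ 1 / 2 := hx
      simp only [mem_closedBall, dist_zero_right, norm_smul, Real.norm_ofNat]
      linarith
    · apply ContinuousOn.fun_smul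
      · apply ContinuousOn.inv₀ (by fun_prop)
        intro x hx
        have hx' : 1 / 2 ≤ ‖x‖ := hx
        linarith
      · fun_prop
    · intro x hx
      rw [hx, h2 _ (by simp [norm_smul, hx])]
      norm_num
  have hR1 : ∀ x, ‖R x‖ = 1 := by
    intro x
    simp only [hR]
    split_ifs with h
    · apply h1
      simp only [mem_closedBall, dist_zero_right, norm_smul, Real.norm_ofNat]
      linarith
    · have : ‖x‖ ≠ 0 := by linarith
      rw [norm_smul, norm_inv, norm_norm, inv_mul_cancel₀ this]
  have hS : IsClosed {x : E3 | 3 / 4 ≤ ‖x‖} := isClosed_le continuous_const continuous_norm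
  have hUo : IsOpen {x : E3 | 1 / 2 < ‖x‖} := isOpen_lt continuous_const continuous_norm
  have hU : {x : E3 | 1 / 2 < ‖x‖} ∈ nhdsSet {x : E3 | 3 / 4 ≤ ‖x‖} := by
    rw [hUo.mem_nhdsSet]
    intro x hx
    have hx' : 3 / 4 ≤ ‖x‖ := hx
    show 1 / 2 < ‖x‖
    linarith
  have hRU : ContDiffOn ℝ (1 : ℕ∞) R {x : E3 | 1 / 2 < ‖x‖} := by
    have : ContDiffOn ℝ (1 : ℕ∞) (fun x : E3 => ‖x‖⁻¹ • x) {x : E3 | 1 / 2 < ‖x‖} := by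
      intro x hx
      have hx' : 1 / 2 < ‖x‖ := hx
      have h0 : x ≠ 0 := by rintro rfl; simp at hx'; linarith
      apply ContDiffAt.contDiffWithinAt
      exact ((contDiffAt_norm ℝ h0).inv (norm_ne_zero_iff.mpr h0)).smul contDiffAt_id
    refine this.congr ?_
    intro x hx
    have hx' : 1 / 2 < ‖x‖ := hx
    simp only [hR, if_neg (not_le.mpr hx')]
  obtain ⟨G, hG, hGR, hGS, -⟩ := hRc.exists_contDiff_approx_and_eqOn 1
    (ε := fun _ => 1 / 2) continuous_const (fun _ => by norm_num) hS hU hRU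
  have hG0 : ∀ x, G x ≠ 0 := by
    intro x hx
    have := hGR x
    rw [hx, dist_zero_left, hR1] at this
    norm_num at this
  refine no_smooth_retraction (fun x => ‖G x‖⁻¹ • G x) ?_ ?_ ?_
  · exact ((ContDiff.norm ℝ hG hG0).inv (fun x => norm_ne_zero_iff.mpr (hG0 x))).smul hG
  · intro x
    rw [norm_smul, norm_inv, norm_norm, inv_mul_cancel₀ (norm_ne_zero_iff.mpr (hG0 x))]
  · intro x hx
    have hx1 : ‖x‖ = 1 := by simpa using hx
    have : G x = x := by
      rw [hGS (show 3 / 4 ≤ ‖x‖ by rw [hx1]; norm_num)]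
      simp only [hR, hx1]
      norm_num
    rw [this, hx1]; simp

lemma norm_one_iff (x : E3) : ‖x‖ = 1 ↔ x 0 ^ 2 + x 1 ^ 2 + x 2 ^ 2 = 1 := by
  have h := EuclideanSpace.real_norm_sq_eq x
  rw [Fin.sum_univ_three] at h
  rw [← h, pow_eq_one_iff_of_nonneg (norm_nonneg _) two_ne_zero]

/-- outer square -/
def outer (n : E3) : M3 := Matrix.vecMulVec (fun i => n i) (fun i => n i)

lemma outer_smul (s : ℝ) (n : E3) : outer (s • n) = s ^ 2 • outer n := by
  ext i j
  simp [outer, Matrix.vecMulVec_apply]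
  ring

/-- matrix acting on vector -/
def act (P : M3) (v : E3) : E3 := WithLp.toLp 2 (P *ᵥ (fun i => v i))

lemma act_outer (u v : E3) : act (outer u) v = (u 0 * v 0 + u 1 * v 1 + u 2 * v 2) • u := by
  ext i
  simp [act, outer, Matrix.mulVec, dotProduct, Matrix.vecMulVec_apply, Fin.sum_univ_three]
  ring

lemma close_ne (u v : E3) (hu : ‖u‖ = 1) (hv : ‖v‖ = 1) (h : dist (outer u) (outer v) < 1 / 9) :
    u 0 * v 0 + u 1 * v 1 + u 2 * v 2 ≠ 0 := by
  intro h0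
  rw [norm_one_iff] at hu hv
  rw [dist_eq_norm, Matrix.norm_lt_iff (by norm_num)] at h
  have hij : ∀ i j, (u i * u j - v i * v j) ^ 2 ≤ 1 / 81 := by
    intro i j
    have := h i j
    simp only [outer, Matrix.sub_apply, Matrix.vecMulVec_apply, Real.norm_eq_abs] at this
    rw [← sq_abs]
    have h3 := abs_nonneg (u i * u j - v i * v j)
    nlinarith
  have key : ∑ i, ∑ j, (u i * u j - v i * v j) ^ 2 = 2 := by
    have : ∑ i, ∑ j, (u i * u j - v i * v j) ^ 2 = (u 0 ^ 2 + u 1 ^ 2 + u 2 ^ 2) ^ 2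
      + (v 0 ^ 2 + v 1 ^ 2 + v 2 ^ 2) ^ 2 - 2 * (u 0 * v 0 + u 1 * v 1 + u 2 * v 2) ^ 2 := by
      simp only [Fin.sum_univ_three]; ring
    rw [this, hu, hv, h0]; norm_num
  have : ∑ i : Fin 3, ∑ j : Fin 3, (u i * u j - v i * v j) ^ 2 ≤ ∑ i : Fin 3, ∑ j : Fin 3, (1 / 81 : ℝ) :=
    Finset.sum_le_sum fun i _ => Finset.sum_le_sum fun j _ => hij i j
  rw [key] at this
  norm_num at this

lemma lift_step (S : Set E3) (P : E3 → M3) (hP : ContinuousOn P S)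
    (hPu : ∀ x ∈ S, ∃ u : E3, ‖u‖ = 1 ∧ P x = outer u)
    (v : E3 → E3) (hv : ContinuousOn v S) (hv1 : ∀ x ∈ S, ‖v x‖ = 1)
    (hclose : ∀ x ∈ S, dist (P x) (outer (v x)) < 1 / 9) :
    ∃ w : E3 → E3, ContinuousOn w S ∧ ∀ x ∈ S, ‖w x‖ = 1 ∧ outer (w x) = P x := by
  have hne : ∀ x ∈ S, ∃ u : E3, ∃ s : ℝ, ‖u‖ = 1 ∧ P x = outer u ∧ s ≠ 0 ∧ act (P x) (v x) = s • u := by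
    intro x hx
    obtain ⟨u, hu, hPx⟩ := hPu x hx
    refine ⟨u, u 0 * v x 0 + u 1 * v x 1 + u 2 * v x 2, hu, hPx, ?_, ?_⟩
    · exact close_ne u (v x) hu (hv1 x hx) (hPx ▸ hclose x hx)
    · rw [hPx, act_outer]
  have hact : ContinuousOn (fun x => act (P x) (v x)) S := by
    unfold act
    apply (PiLp.continuous_toLp 2 _).comp_continuousOn
    rw [continuousOn_pi]
    intro i
    simp only [Matrix.mulVec, dotProduct]
    apply continuousOn_finsetSum
    intro j _
    apply ContinuousOn.mul
    · have : Continuous (fun M : M3 => M i j) := by fun_prop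
      exact this.comp_continuousOn hP
    · have : Continuous (fun M : E3 => M j) := by fun_prop
      exact this.comp_continuousOn hv
  have hs0 : ∀ x ∈ S, ‖act (P x) (v x)‖ ≠ 0 := by
    intro x hx
    obtain ⟨u, s, hu, hPx, hs, ha⟩ := hne x hx
    rw [ha, norm_smul, hu, mul_one]
    simpa using hs
  refine ⟨fun x => ‖act (P x) (v x)‖⁻¹ • act (P x) (v x), ?_, ?_⟩
  · exact (hact.norm.inv₀ hs0).smul hact
  · intro x hx
    refine ⟨?_, ?_⟩
    · rw [norm_smul, norm_inv, norm_norm, inv_mul_cancel₀ (hs0 x hx)]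
    · obtain ⟨u, s, hu, hPx, hs, ha⟩ := hne x hx
      simp only [ha]
      rw [norm_smul, hu, mul_one, smul_smul, outer_smul, hPx, mul_pow, inv_pow, Real.norm_eq_abs,
        sq_abs, inv_mul_cancel₀ (pow_ne_zero 2 hs), one_smul]

lemma lift_ball (P : E3 → M3) (hP : ContinuousOn P (closedBall 0 1))
    (hPu : ∀ x ∈ closedBall (0 : E3) 1, ∃ u : E3, ‖u‖ = 1 ∧ P x = outer u) :
    ∃ w : E3 → E3, ContinuousOn w (closedBall 0 1) ∧
      ∀ x ∈ closedBall (0 : E3) 1, ‖w x‖ = 1 ∧ outer (w x) = P x := by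
  have hUC := (isCompact_closedBall (0 : E3) 1).uniformContinuousOn_of_continuous hP
  replace hUC := Metric.uniformContinuousOn_iff.mp hUC
  obtain ⟨δ, hδ, hUC⟩ := hUC (1 / 9) (by norm_num)
  obtain ⟨m, hm⟩ := exists_nat_one_div_lt hδ
  have hm0 : (0 : ℝ) < m + 1 := by positivity
  have hmem : ∀ k : ℕ, k ≤ m + 1 → ∀ x ∈ closedBall (0 : E3) 1,
      ((k : ℝ) / (m + 1)) • x ∈ closedBall (0 : E3) 1 := by
    intro k hk x hx
    have hx' : ‖x‖ ≤ 1 := by simpa using hx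
    have hk' : (k : ℝ) ≤ m + 1 := by exact_mod_cast hk
    have h0 : (0 : ℝ) ≤ (k : ℝ) / (m + 1) := by positivity
    rw [mem_closedBall_zero_iff, norm_smul, Real.norm_of_nonneg h0]
    exact mul_le_one₀ ((div_le_one hm0).mpr hk') (norm_nonneg _) hx'
  have main : ∀ k : ℕ, k ≤ m + 1 → ∃ w : E3 → E3, ContinuousOn w (closedBall 0 1) ∧
      ∀ x ∈ closedBall (0 : E3) 1, ‖w x‖ = 1 ∧ outer (w x) = P (((k : ℝ) / (m + 1)) • x) := by
    intro k
    induction k with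
    | zero =>
      intro _
      obtain ⟨u, hu, hPu0⟩ := hPu 0 (by simp)
      exact ⟨fun _ => u, continuousOn_const, fun x _ => ⟨hu, by simp [hPu0]⟩⟩
    | succ k ih =>
      intro hk
      obtain ⟨v, hv, hv1⟩ := ih (by omega)
      apply lift_step _ (fun x => P ((((k + 1 : ℕ) : ℝ) / (m + 1)) • x)) _ _ v hv
        (fun x hx => (hv1 x hx).1)
      · intro x hx
        rw [(hv1 x hx).2]
        apply hUC _ (hmem _ hk x hx) _ (hmem _ (by omega) x hx)
        have hx' : ‖x‖ ≤ 1 := by simpa using hx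
        rw [dist_eq_norm, ← sub_smul, norm_smul]
        have : (((k + 1 : ℕ) : ℝ) / (m + 1)) - (k : ℝ) / (m + 1) = 1 / (m + 1) := by
          push_cast; ring
        rw [this, Real.norm_of_nonneg (by positivity)]
        exact lt_of_le_of_lt (mul_le_of_le_one_right (by positivity) hx') hm
      · exact hP.comp (by fun_prop) (hmem _ hk)
      · intro x hx
        exact hPu _ (hmem _ hk x hx)
  obtain ⟨w, hw, hw1⟩ := main (m + 1) le_rfl
  refine ⟨w, hw, fun x hx => ?_⟩
  have := hw1 x hx
  push_cast at this
  rwa [div_self hm0.ne', one_smul] at this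

/-- no continuous retraction-type map from the closed unit ball into
the vacuum manifold with the hedgehog boundary values. -/
theorem stmt17 (a b c : ℝ) (ha : 0 ≤ a) (hb : 0 < b) (hc : 0 < c) :
    ¬ ∃ Q : E3 → M3,
      ContinuousOn Q (closedBall (0 : E3) 1) ∧
      (∀ x ∈ closedBall (0 : E3) 1, Q x ∈ Nman a b c) ∧
      (∀ x ∈ sphere (0 : E3) 1,
        Q x = sstar a b c • (Matrix.vecMulVec (fun i => x i) (fun i => x i) - (1 / 3 : ℝ) • (1 : M3))) := by
  rintro ⟨Q, hQ, hQN, hQS⟩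
  have hs : sstar a b c ≠ 0 := by
    unfold sstar
    have := Real.sqrt_nonneg (b ^ 2 + 24 * a * c)
    positivity
  obtain ⟨v, hv, hv1⟩ := lift_ball (fun x => (sstar a b c)⁻¹ • Q x + (1 / 3 : ℝ) • (1 : M3))
    ((hQ.fun_const_smul _).fun_add continuousOn_const) (by
      intro x hx
      obtain ⟨n, hn, hQx⟩ := hQN x hx
      refine ⟨WithLp.toLp 2 n, ?_, ?_⟩
      · rw [norm_one_iff, ← hn, Fin.sum_univ_three]
      · simp only [hQx, inv_smul_smul₀ hs, outer]
        simp)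
  have hinner : ∀ x y : E3, inner ℝ x y = x 0 * y 0 + x 1 * y 1 + x 2 * y 2 := by
    intro x y
    simp [PiLp.inner_apply, Fin.sum_univ_three]
    ring
  have hsq : EqOn ((fun x => inner ℝ x (v x)) ^ 2) ((fun _ : E3 => (1 : ℝ)) ^ 2) (sphere (0 : E3) 1) := by
    intro x hx
    obtain ⟨h1, h2⟩ := hv1 x (sphere_subset_closedBall hx)
    simp only [hQS x hx, inv_smul_smul₀ hs, sub_add_cancel] at h2
    have h3 := act_outer (v x) (v x)
    have hx1 : ‖x‖ = 1 := by simpa using hx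
    have hout : outer (v x) = outer x := h2
    have e : ∀ i j, v x i * v x j = x i * x j := by
      intro i j
      have := congrFun (congrFun hout i) j
      simpa [outer, Matrix.vecMulVec_apply] using this
    rw [norm_one_iff] at hx1
    simp only [Pi.pow_apply, hinner]
    have : (x 0 * v x 0 + x 1 * v x 1 + x 2 * v x 2) ^ 2 = x 0 ^ 2 * (v x 0 * v x 0)
      + x 1 ^ 2 * (v x 1 * v x 1) + x 2 ^ 2 * (v x 2 * v x 2) + 2 * x 0 * x 1 * (v x 0 * v x 1)
      + 2 * x 0 * x 2 * (v x 0 * v x 2) + 2 * x 1 * x 2 * (v x 1 * v x 2) := by ring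
    rw [this]
    simp only [e]
    calc _ = (x 0 ^ 2 + x 1 ^ 2 + x 2 ^ 2) ^ 2 := by ring
      _ = _ := by rw [hx1]
  have hrank : 1 < Module.rank ℝ E3 := by
    rw [← Module.finrank_eq_rank, finrank_euclideanSpace_fin]
    norm_num
  have hpc := isPreconnected_sphere hrank (0 : E3) 1
  have hcont : ContinuousOn (fun x => inner ℝ x (v x)) (sphere (0 : E3) 1) :=
    continuousOn_id.inner (hv.mono sphere_subset_closedBall)
  rcases hpc.eq_or_eq_neg_of_sq_eq hcont continuousOn_const hsq (by intros; norm_num) with h | h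
  · refine no_retraction v hv (fun x hx => (hv1 x hx).1) (fun x hx => ?_)
    have hx1 : ‖x‖ = 1 := by simpa using hx
    exact ((inner_eq_one_iff_of_norm_eq_one hx1 (hv1 x (sphere_subset_closedBall hx)).1).mp (h hx)).symm
  · refine no_retraction (fun x => - v x) hv.neg (fun x hx => by rw [norm_neg]; exact (hv1 x hx).1)
      (fun x hx => ?_)
    have hx1 : ‖x‖ = 1 := by simpa using hx
    have hn1 : ‖-v x‖ = 1 := by rw [norm_neg]; exact (hv1 x (sphere_subset_closedBall hx)).1
    refine ((inner_eq_one_iff_of_norm_eq_one (𝕜 := ℝ) hx1 hn1).mp ?_).symm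
    rw [inner_neg_right]
    have : inner ℝ x (v x) = -1 := by simpa using h hx
    rw [this]; norm_num

end
end
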